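/- arXiv:2303.11872 — 8 statements merged into one kernel-verified Lean document; each statement's English description precedes it below -/
import Mathlib

section
/- Let k ≥ 1 be an integer, let ρ be a root of S_k(x), and let K = ℚ(ρ). Then the discriminant of the power basis {1, ρ, ρ²} of K over ℚ (equivalently, the discriminant of the polynomial S_k) equals (k² + 3k + 9)². -/
open Polynomial IntermediateField

/-- Multiplication by a root of a monic cubic, in the basis `{1, ρ, ρ²}`, is the companion matrix. -/
lemma leftMulMatrix_of_cubic {R A : Type*} [CommRing R] [CommRing A] [Algebra R A]
    (B : Module.Basis (Fin 3) R A) {ρ : A} (hB : ⇑B = ![1, ρ, ρ ^ 2]) {a b c : R}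
    (h : ρ ^ 3 = a • ρ ^ 2 + b • ρ + c • 1) :
    Algebra.leftMulMatrix B ρ = !![0, 0, c; 1, 0, b; 0, 1, a] := by
  have h0 : B 0 = 1 := by simp [hB]
  have h1 : B 1 = ρ := by simp [hB]
  have h2 : B 2 = ρ ^ 2 := by simp [hB]
  have e0 : ρ * B 0 = B 1 := by rw [h0, h1, mul_one]
  have e1 : ρ * B 1 = B 2 := by rw [h1, h2, sq]
  have e2 : ρ * B 2 = a • B 2 + b • B 1 + c • B 0 := by
    rw [h0, h1, h2, ← h, ← pow_succ']
  ext i j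
  rw [Algebra.leftMulMatrix_eq_repr_mul]
  fin_cases j
  · simp only [Fin.zero_eta, e0]
    fin_cases i <;> simp
  · simp only [Fin.mk_one, e1]
    fin_cases i <;> simp
  · simp only [Fin.reduceFinMk, e2]
    fin_cases i <;> simp

/-- The discriminant of the basis `{1, ρ, ρ²}`, where `ρ ^ 3 = a * ρ ^ 2 + b * ρ + c`. -/
lemma discr_of_cubic {R A : Type*} [CommRing R] [CommRing A] [Algebra R A]
    (B : Module.Basis (Fin 3) R A) {ρ : A} (hB : ⇑B = ![1, ρ, ρ ^ 2]) {a b c : R}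
    (h : ρ ^ 3 = a • ρ ^ 2 + b • ρ + c • 1) :
    Algebra.discr R ![1, ρ, ρ ^ 2] =
      a ^ 2 * b ^ 2 + 4 * b ^ 3 - 4 * a ^ 3 * c - 18 * a * b * c - 27 * c ^ 2 := by
  have trace_pow (n : ℕ) : Algebra.trace R A (ρ ^ n) =
      (!![0, 0, c; 1, 0, b; 0, 1, a] ^ n).trace := by
    rw [Algebra.trace_eq_matrix_trace B, map_pow, leftMulMatrix_of_cubic B hB h]
  have t0 : Algebra.trace R A 1 = 3 := by
    simpa [Matrix.trace_fin_three] using trace_pow 0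
  have t1 : Algebra.trace R A ρ = a := by
    simpa [Matrix.trace_fin_three] using trace_pow 1
  have t2 : Algebra.trace R A (ρ ^ 2) = a ^ 2 + 2 * b := by
    rw [trace_pow]
    simp [pow_succ, Matrix.trace_fin_three]
    ring
  have t3 : Algebra.trace R A (ρ ^ 3) = a * (a ^ 2 + 2 * b) + b * a + 3 * c := by
    rw [h]
    simp only [map_add, map_smul, t0, t1, t2, smul_eq_mul]
    ring
  have t4 : Algebra.trace R A (ρ ^ 4) =
      a * (a * (a ^ 2 + 2 * b) + b * a + 3 * c) + b * (a ^ 2 + 2 * b) + c * a := by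
    have h4 : ρ ^ 4 = a • ρ ^ 3 + b • ρ ^ 2 + c • ρ := by
      rw [pow_succ' ρ 3]
      nth_rewrite 1 [h]
      simp only [mul_add, mul_smul_comm, mul_one, ← pow_succ', ← sq]
    rw [h4]
    simp only [map_add, map_smul, t1, t2, t3, smul_eq_mul]
  have m11 : ρ * ρ = ρ ^ 2 := by ring
  have m12 : ρ * ρ ^ 2 = ρ ^ 3 := by ring
  have m21 : ρ ^ 2 * ρ = ρ ^ 3 := by ring
  have m22 : ρ ^ 2 * ρ ^ 2 = ρ ^ 4 := by ring
  rw [Algebra.discr_def, Matrix.det_fin_three]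
  simp only [Algebra.traceMatrix_apply, Algebra.traceForm_apply, Matrix.cons_val, one_mul, mul_one,
    m11, m12, m21, m22, t0, t1, t2, t3, t4]
  ring

/-- The Shanks polynomial has no rational root. -/
lemma shanks_ne_zero (k : ℤ) (hk : 1 ≤ k) (x : ℚ) :
    x ^ 3 - (k : ℚ) * x ^ 2 - ((k : ℚ) + 3) * x - 1 ≠ 0 := by
  intro hx
  have hint : IsIntegral ℤ x := by
    refine ⟨X ^ 3 - C k * X ^ 2 - C (k + 3) * X - C 1, by monicity!, ?_⟩
    simp only [eval₂_sub, eval₂_mul, eval₂_pow, eval₂_X, eval₂_C]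
    simpa using hx
  obtain ⟨n, rfl⟩ := IsIntegrallyClosed.isIntegral_iff.mp hint
  simp only [algebraMap_int_eq, eq_intCast] at hx
  have hn : n ^ 3 - k * n ^ 2 - (k + 3) * n - 1 = 0 := by exact_mod_cast hx
  have hu : IsUnit n := IsUnit.of_mul_eq_one (n ^ 2 - k * n - (k + 3)) (by linarith)
  rcases Int.isUnit_iff.mp hu with rfl | rfl <;> norm_num at hn <;> omega

/-- Let `k ≥ 1`, let `ρ` be a root of the Shanks polynomial
`S_k(x) = x³ − k·x² − (k+3)·x − 1` and `K = ℚ(ρ)`.  Then the discriminant of the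
power basis `{1, ρ, ρ²}` of `K` over `ℚ` equals `(k² + 3k + 9)²`. -/
theorem shanks_discr (k : ℤ) (hk : 1 ≤ k)
    (K : Type*) [Field K] [NumberField K] (ρ : K)
    (hρ : ρ ^ 3 - (k : K) * ρ ^ 2 - ((k : K) + 3) * ρ - 1 = 0)
    (hgen : ℚ⟮ρ⟯ = ⊤) :
    Algebra.discr ℚ ![1, ρ, ρ ^ 2] = ((k : ℚ) ^ 2 + 3 * k + 9) ^ 2 := by
  set S : ℚ[X] := X ^ 3 - C (k : ℚ) * X ^ 2 - C ((k : ℚ) + 3) * X - C 1 with hS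
  have hdeg : S.natDegree = 3 := by rw [hS]; compute_degree!
  have hmonic : S.Monic := by rw [hS]; monicity!
  have hirr : Irreducible S := by
    refine (irreducible_iff_roots_eq_zero_of_degree_le_three (by omega) (by omega)).mpr ?_
    refine Multiset.eq_zero_of_forall_notMem fun x hx => shanks_ne_zero k hk x ?_
    simpa [hS] using isRoot_of_mem_roots hx
  have hmin : minpoly ℚ ρ = S :=
    (minpoly.eq_of_irreducible_of_monic hirr (by simpa [hS] using hρ) hmonic).symm
  have hfin : Module.finrank ℚ K = 3 := by
    rw [← IntermediateField.finrank_top', ← hgen,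
      adjoin.finrank (Algebra.IsIntegral.isIntegral ρ), hmin, hdeg]
  have hli : LinearIndependent ℚ ![1, ρ, ρ ^ 2] := by
    have hpow := linearIndependent_pow (K := ℚ) ρ
    rw [hmin, hdeg] at hpow
    have hvec : ![1, ρ, ρ ^ 2] = fun i : Fin 3 => ρ ^ (i : ℕ) := by
      ext i
      fin_cases i <;> simp
    rwa [hvec]
  have hcubic : ρ ^ 3 = (k : ℚ) • ρ ^ 2 + ((k : ℚ) + 3) • ρ + (1 : ℚ) • 1 := by
    simp only [Algebra.smul_def, map_add, map_intCast, map_ofNat, map_one]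
    linear_combination hρ
  rw [discr_of_cubic (basisOfLinearIndependentOfCardEqFinrank hli (by simp [hfin]))
    (coe_basisOfLinearIndependentOfCardEqFinrank hli _) hcubic]
  ring
end

section
/- Let k ≥ 1 be an integer and suppose ρ is a root of S_k(x) in a field of characteristic 0 (e.g. in ℂ). Then ρ ≠ 0, ρ ≠ −1, the elements σ = ρ² − (k+1)ρ − 2 and τ = −ρ² + kρ + k + 2 are also roots of S_k, and moreover σ = −1/(ρ+1) and τ = −(ρ+1)/ρ. -/
/-- Let `k ≥ 1` and suppose `ρ` is a root of the Shanks polynomial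
`S_k(x) = x³ − k·x² − (k+3)·x − 1` in a field `F` of characteristic `0`.  Then
`ρ ≠ 0`, `ρ ≠ −1`, the elements `σ = ρ² − (k+1)ρ − 2` and `τ = −ρ² + kρ + k + 2`
are also roots of `S_k`, and moreover `σ = −1/(ρ+1)` and `τ = −(ρ+1)/ρ`. -/
theorem shanks_other_roots (k : ℤ) (hk : 1 ≤ k)
    (F : Type*) [Field F] [CharZero F] (ρ : F)
    (hρ : ρ ^ 3 - (k : F) * ρ ^ 2 - ((k : F) + 3) * ρ - 1 = 0) :
    ρ ≠ 0 ∧ ρ ≠ -1 ∧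
    (ρ ^ 2 - ((k : F) + 1) * ρ - 2) ^ 3 - (k : F) * (ρ ^ 2 - ((k : F) + 1) * ρ - 2) ^ 2
      - ((k : F) + 3) * (ρ ^ 2 - ((k : F) + 1) * ρ - 2) - 1 = 0 ∧
    (-ρ ^ 2 + (k : F) * ρ + (k : F) + 2) ^ 3 - (k : F) * (-ρ ^ 2 + (k : F) * ρ + (k : F) + 2) ^ 2
      - ((k : F) + 3) * (-ρ ^ 2 + (k : F) * ρ + (k : F) + 2) - 1 = 0 ∧
    ρ ^ 2 - ((k : F) + 1) * ρ - 2 = -1 / (ρ + 1) ∧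
    -ρ ^ 2 + (k : F) * ρ + (k : F) + 2 = -(ρ + 1) / ρ := by
  have h₀ : ρ ≠ 0 := by
    rintro rfl
    simp at hρ
  have h₁ : ρ + 1 ≠ 0 := fun h => one_ne_zero (α := F) <| by
    linear_combination hρ - (ρ ^ 2 - ((k : F) + 1) * ρ - 2) * h
  have hσ : ρ ^ 2 - ((k : F) + 1) * ρ - 2 = -1 / (ρ + 1) := by
    rw [eq_div_iff h₁]
    linear_combination hρ
  have hτ : -ρ ^ 2 + (k : F) * ρ + (k : F) + 2 = -(ρ + 1) / ρ := by
    rw [eq_div_iff h₀]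
    linear_combination -hρ
  refine ⟨h₀, fun h => h₁ (by rw [h, neg_add_cancel]), ?_, ?_, hσ, hτ⟩
  · rw [hσ]
    field_simp
    linear_combination -hρ
  · rw [hτ]
    field_simp
    linear_combination hρ
end

section
/- Let k ≥ 1 be an integer, let ρ be a root of S_k(x), and let K = ℚ(ρ) with ring of integers Z_K. Then ρ and ρ + 1 are units of Z_K, and they are multiplicatively independent: if r, s ∈ ℤ satisfy ρ^r (ρ+1)^s = 1 or ρ^r (ρ+1)^s = −1, then r = s = 0. Moreover, the unit group of K has rank 2. -/
open IntermediateField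

open Polynomial in
/-- The Shanks polynomial `x³ − k·x² − (k+3)·x − 1` over `ℤ`. -/
noncomputable def shanksPolynomial (k : ℤ) : ℤ[X] :=
  X ^ 3 - C k * X ^ 2 - C (k + 3) * X - 1

namespace shanksPolynomial

open Polynomial

theorem natDegree_eq (k : ℤ) : (shanksPolynomial k).natDegree = 3 := by
  unfold shanksPolynomial
  compute_degree!

theorem monic (k : ℤ) : (shanksPolynomial k).Monic := by
  unfold shanksPolynomial
  monicity!

theorem aeval_eq {R : Type*} [CommRing R] (k : ℤ) (x : R) :
    aeval x (shanksPolynomial k) = x ^ 3 - (k : R) * x ^ 2 - ((k : R) + 3) * x - 1 := by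
  simp [shanksPolynomial, map_ofNat (aeval x) 3]

theorem aeval_ne_zero {k : ℤ} (hk : 1 ≤ k) (x : ℚ) : aeval x (shanksPolynomial k) ≠ 0 := by
  intro hx
  obtain ⟨n, rfl⟩ := isInteger_of_is_root_of_monic (monic k) hx
  rw [aeval_eq, eq_intCast] at hx
  have hn : n ^ 3 - k * n ^ 2 - (k + 3) * n - 1 = 0 := by exact_mod_cast hx
  have hunit : IsUnit n := IsUnit.of_mul_eq_one (n ^ 2 - k * n - (k + 3)) (by linear_combination hn)
  rcases Int.isUnit_iff.mp hunit with rfl | rfl <;> omega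

theorem irreducible_map {k : ℤ} (hk : 1 ≤ k) :
    Irreducible ((shanksPolynomial k).map (algebraMap ℤ ℚ)) := by
  refine irreducible_of_degree_le_three_of_not_isRoot ?_ fun x hx ↦ aeval_ne_zero hk x ?_
  · rw [(monic k).natDegree_map, natDegree_eq]
    decide
  · rwa [IsRoot.def, eval_map_algebraMap] at hx

theorem minpoly_eq {k : ℤ} (hk : 1 ≤ k) {K : Type*} [Field K] [Algebra ℚ K] {x : K}
    (hx : aeval x (shanksPolynomial k) = 0) :
    minpoly ℚ x = (shanksPolynomial k).map (algebraMap ℤ ℚ) :=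
  (minpoly.eq_of_irreducible_of_monic (irreducible_map hk) (by rwa [aeval_map_algebraMap])
    ((monic k).map _)).symm

theorem exists_pos_root {k : ℤ} (hk : 1 ≤ k) :
    ∃ a : ℝ, 0 < a ∧ a ^ 3 - k * a ^ 2 - (k + 3) * a - 1 = 0 := by
  have hk' : (1 : ℝ) ≤ k := by exact_mod_cast hk
  have hcont : ContinuousOn (fun a : ℝ ↦ a ^ 3 - k * a ^ 2 - (k + 3) * a - 1)
      (Set.Icc 0 (k + 3)) := by fun_prop
  obtain ⟨a, ha, h0⟩ := intermediate_value_Icc (by linarith) hcont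
    (show (0 : ℝ) ∈ _ from ⟨by norm_num, by nlinarith⟩)
  refine ⟨a, ha.1.lt_of_ne ?_, h0⟩
  rintro rfl
  norm_num at h0

/-- The roots of the Shanks polynomial are permuted by `x ↦ -1 / (1 + x)`. -/
theorem root_trichotomy {F : Type*} [Field F] {k a z : F} (ha₀ : a ≠ 0) (ha₁ : 1 + a ≠ 0)
    (ha : a ^ 3 - k * a ^ 2 - (k + 3) * a - 1 = 0)
    (hz : z ^ 3 - k * z ^ 2 - (k + 3) * z - 1 = 0) :
    z = a ∨ z = -1 / (1 + a) ∨ z = -(1 + a) / a := by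
  have h : (z - a) * (z * (1 + a) + 1) * (z * a + (1 + a)) = 0 := by
    linear_combination a * (1 + a) * hz - (z ^ 2 + z) * ha
  rcases mul_eq_zero.mp h with h | h
  · rcases mul_eq_zero.mp h with h | h
    · exact .inl (sub_eq_zero.mp h)
    · exact .inr (.inl ((eq_div_iff ha₁).mpr (by linear_combination h)))
  · exact .inr (.inr ((eq_div_iff ha₀).mpr (by linear_combination h)))

theorem root_neg_one_div {F : Type*} [Field F] {k a : F} (ha₁ : 1 + a ≠ 0)
    (ha : a ^ 3 - k * a ^ 2 - (k + 3) * a - 1 = 0) :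
    (-1 / (1 + a)) ^ 3 - k * (-1 / (1 + a)) ^ 2 - (k + 3) * (-1 / (1 + a)) - 1 = 0 := by
  field_simp
  linear_combination -ha

theorem conj_eq_self {k : ℤ} (hk : 1 ≤ k) {z : ℂ} (hz : aeval z (shanksPolynomial k) = 0) :
    starRingEnd ℂ z = z := by
  obtain ⟨a, ha₀, ha⟩ := exists_pos_root hk
  rw [aeval_eq] at hz
  rw [Complex.conj_eq_iff_real]
  have ha₁ : (1 : ℝ) + a ≠ 0 := by positivity
  rcases root_trichotomy (k := (k : ℂ)) (a := (a : ℂ)) (by exact_mod_cast ha₀.ne')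
    (by exact_mod_cast ha₁) (by exact_mod_cast ha) hz with h | h | h
  · exact ⟨a, h⟩
  · exact ⟨-1 / (1 + a), by rw [h]; push_cast; rfl⟩
  · exact ⟨-(1 + a) / a, by rw [h]; push_cast; rfl⟩

variable {K : Type*} [Field K] [NumberField K] {k : ℤ} {x : K}

theorem finrank_eq_three (hk : 1 ≤ k) (hx : aeval x (shanksPolynomial k) = 0)
    (hgen : ℚ⟮x⟯ = ⊤) : Module.finrank ℚ K = 3 := by
  rw [← (Field.primitive_element_iff_minpoly_natDegree_eq ℚ x).mp hgen, minpoly_eq hk hx,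
    (monic k).natDegree_map, natDegree_eq]

theorem isTotallyReal (hk : 1 ≤ k) (hx : aeval x (shanksPolynomial k) = 0)
    (hgen : ℚ⟮x⟯ = ⊤) : NumberField.IsTotallyReal K := by
  refine ⟨fun v ↦ NumberField.InfinitePlace.isReal_iff.mpr ?_⟩
  rw [NumberField.ComplexEmbedding.isReal_iff]
  set φ := v.embedding
  have hφ : aeval (φ x) (shanksPolynomial k) = 0 := by
    simpa [hx] using aeval_algHom_apply φ.toIntAlgHom x (shanksPolynomial k)
  have h := (Field.primitive_element_iff_algHom_eq_of_eval ℚ ℂ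
    (fun _ ↦ IsAlgClosed.splits _) x (NumberField.ComplexEmbedding.conjugate φ).toRatAlgHom).mp
    hgen φ.toRatAlgHom (conj_eq_self hk hφ)
  ext y
  exact DFunLike.congr_fun h y

theorem rank_units_eq_two (hk : 1 ≤ k) (hx : aeval x (shanksPolynomial k) = 0)
    (hgen : ℚ⟮x⟯ = ⊤) : NumberField.Units.rank K = 2 := by
  have := isTotallyReal hk hx hgen
  rw [NumberField.Units.rank, NumberField.InfinitePlace.card_eq_nrRealPlaces_add_nrComplexPlaces,
    NumberField.IsTotallyReal.nrComplexPlaces_eq_zero, ← NumberField.IsTotallyReal.finrank,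
    finrank_eq_three hk hx hgen]

theorem exists_embedding_eq (hk : 1 ≤ k) (hx : aeval x (shanksPolynomial k) = 0) {z : ℝ}
    (hz : z ^ 3 - k * z ^ 2 - (k + 3) * z - 1 = 0) : ∃ φ : K →+* ℂ, φ x = z := by
  have hmem : (z : ℂ) ∈ (minpoly ℚ x).rootSet ℂ := by
    rw [mem_rootSet, minpoly_eq hk hx, aeval_map_algebraMap, aeval_eq]
    exact ⟨(irreducible_map hk).ne_zero, by exact_mod_cast hz⟩
  rw [← Algebra.IsAlgebraic.range_eval_eq_rootSet_minpoly] at hmem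
  obtain ⟨ψ, hψ⟩ := hmem
  exact ⟨ψ, hψ⟩

end shanksPolynomial

/-- A multiplicative relation up to sign becomes a linear relation between logarithms of absolute
values under any real-valued embedding. -/
theorem Units.mul_log_add_mul_log_eq_zero {R : Type*} [CommRing R] (φ : R →+* ℂ) {u v : Rˣ}
    {r s : ℤ} (h : u ^ r * v ^ s = 1 ∨ u ^ r * v ^ s = -1) {a b : ℝ} (ha : φ u = a)
    (hb : φ v = b) : r * Real.log a + s * Real.log b = 0 := by
  have hu : a ≠ 0 := by
    have := (u.isUnit.map φ).ne_zero
    rw [ha] at this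
    exact_mod_cast this
  have hv : b ≠ 0 := by
    have := (v.isUnit.map φ).ne_zero
    rw [hb] at this
    exact_mod_cast this
  have hC : ((Units.map (φ : R →* ℂ) (u ^ r * v ^ s) : ℂˣ) : ℂ) = a ^ r * b ^ s := by
    simp [ha, hb]
  have hab : a ^ r * b ^ s = 1 ∨ a ^ r * b ^ s = -1 := by
    refine h.imp (fun h ↦ ?_) (fun h ↦ ?_) <;> rw [h] at hC <;> simp at hC
    · exact_mod_cast hC.symm
    · exact_mod_cast hC.symm
  have hlog : Real.log (a ^ r * b ^ s) = 0 := by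
    rcases hab with h | h <;> simp [h]
  rwa [Real.log_mul (zpow_ne_zero _ hu) (zpow_ne_zero _ hv), Real.log_zpow, Real.log_zpow] at hlog

/-- Let `k ≥ 1`, let `ρ` be a root of the Shanks polynomial
`S_k(x) = x³ − k·x² − (k+3)·x − 1` and `K = ℚ(ρ)`, with ring of integers `𝓞 K`.
Then `ρ` and `ρ + 1` are units of `𝓞 K`, they are multiplicatively independent
(`ρ^r (ρ+1)^s = ±1` forces `r = s = 0`), and the unit group of `K` has rank `2`. -/
theorem shanks_units (k : ℤ) (hk : 1 ≤ k)
    (K : Type*) [Field K] [NumberField K] (ρ : NumberField.RingOfIntegers K)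
    (hρ : ρ ^ 3 - (k : NumberField.RingOfIntegers K) * ρ ^ 2
      - ((k : NumberField.RingOfIntegers K) + 3) * ρ - 1 = 0)
    (hgen : ℚ⟮(ρ : K)⟯ = ⊤) :
    (∃ u v : (NumberField.RingOfIntegers K)ˣ, (u : NumberField.RingOfIntegers K) = ρ ∧
      (v : NumberField.RingOfIntegers K) = ρ + 1 ∧
      ∀ r s : ℤ, (u ^ r * v ^ s = 1 ∨ u ^ r * v ^ s = -1) → r = 0 ∧ s = 0) ∧
    NumberField.Units.rank K = 2 := by
  have hx : Polynomial.aeval (ρ : K) (shanksPolynomial k) = 0 := by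
    rw [Polynomial.aeval_algebraMap_apply, shanksPolynomial.aeval_eq, hρ, map_zero]
  refine ⟨?_, shanksPolynomial.rank_units_eq_two hk hx hgen⟩
  have hu : ρ * (ρ ^ 2 - k * ρ - (k + 3)) = 1 := by linear_combination hρ
  have hv : (ρ + 1) * (2 + (k + 1) * ρ - ρ ^ 2) = 1 := by linear_combination -hρ
  refine ⟨.mkOfMulEqOne _ _ hu, .mkOfMulEqOne _ _ hv, rfl, rfl, fun r s h ↦ ?_⟩
  obtain ⟨a, ha₀, ha⟩ := shanksPolynomial.exists_pos_root hk
  have ha₁ : 1 + a ≠ 0 := by positivity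
  obtain ⟨φ, hφ⟩ := shanksPolynomial.exists_embedding_eq hk hx ha
  obtain ⟨ψ, hψ⟩ := shanksPolynomial.exists_embedding_eq hk hx
    (shanksPolynomial.root_neg_one_div ha₁ ha)
  have h₁ := Units.mul_log_add_mul_log_eq_zero
    (φ.comp (algebraMap (NumberField.RingOfIntegers K) K)) h (a := a) (b := 1 + a)
    hφ (by simp [hφ, add_comm])
  have h₂ := Units.mul_log_add_mul_log_eq_zero
    (ψ.comp (algebraMap (NumberField.RingOfIntegers K) K)) h (a := -1 / (1 + a))
    (b := a / (1 + a)) hψ (by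
      have : (1 + a : ℂ) ≠ 0 := by exact_mod_cast ha₁
      simp [hψ]
      field_simp
      ring)
  rw [neg_div, Real.log_neg_eq_log, one_div, Real.log_inv, Real.log_div ha₀.ne' ha₁] at h₂
  have hM : 0 < Real.log (1 + a) := Real.log_pos (by linarith)
  set L := Real.log a
  set M := Real.log (1 + a)
  have hdet : L ^ 2 - L * M + M ^ 2 ≠ 0 := by nlinarith [sq_nonneg (2 * L - M), mul_pos hM hM]
  have hr : (r : ℝ) * (L ^ 2 - L * M + M ^ 2) = 0 := by
    linear_combination (L - M) * h₁ - M * h₂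
  have hs : (s : ℝ) * (L ^ 2 - L * M + M ^ 2) = 0 := by
    linear_combination M * h₁ + L * h₂
  exact ⟨by exact_mod_cast (mul_eq_zero.mp hr).resolve_right hdet,
    by exact_mod_cast (mul_eq_zero.mp hs).resolve_right hdet⟩
end

section
/- Let k ≥ 1 be an integer with k ≢ 3 (mod 9) such that D is squarefree, and let p be a prime. Then the power-compositional polynomial S_k(x^p) = x^{3p} − kx^{2p} − (k+3)x^p − 1 is irreducible over ℚ. -/
open Polynomial

/-- The Shanks polynomial `S_k`. -/
noncomputable def shanks (k : ℤ) : ℤ[X] := X ^ 3 - C k * X ^ 2 - C (k + 3) * X - 1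

lemma shanks_natDegree (k : ℤ) : (shanks k).natDegree = 3 := by
  unfold shanks; compute_degree!

lemma shanks_monic (k : ℤ) : (shanks k).Monic := by
  unfold shanks; monicity!

lemma aeval_shanks {R : Type*} [CommRing R] (k : ℤ) (x : R) :
    aeval x (shanks k) = x ^ 3 - k * x ^ 2 - (k + 3) * x - 1 := by
  simp [shanks, map_ofNat]

lemma shanks_irreducible (k : ℤ) : Irreducible (shanks k) := by
  rw [(shanks_monic k).irreducible_iff_roots_eq_zero_of_degree_le_three
    (by rw [shanks_natDegree]; norm_num) (by rw [shanks_natDegree]),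
    Multiset.eq_zero_iff_forall_notMem]
  intro n hn
  have h : n ^ 3 - k * n ^ 2 - (k + 3) * n - 1 = 0 := by
    simpa [shanks] using isRoot_of_mem_roots hn
  have hdvd : n ∣ 1 := ⟨n ^ 2 - k * n - (k + 3), by linear_combination -h⟩
  rcases Int.isUnit_iff.1 (isUnit_of_dvd_one hdvd) with rfl | rfl <;> ring_nf at h <;> lia

lemma shanks_comp_eisenstein {k c q : ℤ} (hq : Prime q) (h2 : q ∣ 3 * c - k)
    (h1 : q ∣ 3 * c ^ 2 - 2 * k * c - (k + 3)) (h0 : q ∣ c ^ 3 - k * c ^ 2 - (k + 3) * c - 1)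
    (hsq : ¬ q ^ 2 ∣ c ^ 3 - k * c ^ 2 - (k + 3) * c - 1) :
    ((shanks k).comp (X + C c)).IsEisensteinAt (Ideal.span {q}) := by
  have hm : ((shanks k).comp (X + C c)).Monic := (shanks_monic k).comp_X_add_C c
  have hc : (shanks k).comp (X + C c) = X ^ 3 + C (3 * c - k) * X ^ 2 +
      C (3 * c ^ 2 - 2 * k * c - (k + 3)) * X + C (c ^ 3 - k * c ^ 2 - (k + 3) * c - 1) := by
    simp only [shanks, sub_comp, mul_comp, X_comp, C_comp, one_comp, pow_comp]
    simp only [map_sub, map_add, map_mul, map_pow, map_one, show (C 2 : ℤ[X]) = 2 from rfl,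
      show (C 3 : ℤ[X]) = 3 from rfl]
    ring
  generalize 3 * c - k = a2 at *
  generalize 3 * c ^ 2 - 2 * k * c - (k + 3) = a1 at *
  generalize c ^ 3 - k * c ^ 2 - (k + 3) * c - 1 = a0 at *
  refine ⟨?_, fun {n} hn => ?_, ?_⟩
  · rw [hm.leadingCoeff, Ideal.mem_span_singleton]
    exact fun h => hq.not_isUnit (isUnit_of_dvd_one h)
  · rw [natDegree_comp, shanks_natDegree, natDegree_X_add_C] at hn
    rw [hc, Ideal.mem_span_singleton]
    interval_cases n <;> simpa [coeff_X, coeff_C, -eq_intCast]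
  · rw [hc, Ideal.span_singleton_pow, Ideal.mem_span_singleton]
    simpa [coeff_X, coeff_C, -eq_intCast]

/-- Every prime dividing `k² + 3k + 9` admits a shift of `S_k` with Eisenstein coefficients. -/
lemma shanks_exists_shift {k : ℤ} (hk9 : ¬ k ≡ 3 [ZMOD 9])
    (hD : Squarefree (if (3 : ℤ) ∣ k then (k / 3) ^ 2 + k / 3 + 1 else k ^ 2 + 3 * k + 9))
    {q : ℤ} (hq : Prime q) (hqD : q ∣ k ^ 2 + 3 * k + 9) :
    ∃ c : ℤ, q ∣ 3 * c - k ∧ q ∣ 3 * c ^ 2 - 2 * k * c - (k + 3) ∧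
      q ∣ c ^ 3 - k * c ^ 2 - (k + 3) * c - 1 ∧ ¬ q ^ 2 ∣ c ^ 3 - k * c ^ 2 - (k + 3) * c - 1 := by
  by_cases hq3 : q ∣ 3
  · have hk3 : (3 : ℤ) ∣ k := by
      have h3 : (3 : ℤ) ∣ q := (hq.associated_of_dvd Int.prime_three hq3).dvd'
      have := h3.trans hqD
      refine Int.prime_three.dvd_of_dvd_pow (n := 2) ?_
      omega
    obtain ⟨j, rfl⟩ := hk3
    refine ⟨1, hq3.trans ⟨1 - j, by ring⟩, hq3.trans ⟨- 3 * j, by ring⟩,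
      hq3.trans ⟨-(2 * j + 1), by ring⟩, fun h => ?_⟩
    have h3 : (3 : ℤ) ^ 2 ∣ q ^ 2 :=
      pow_dvd_pow_of_dvd (hq.associated_of_dvd Int.prime_three hq3).dvd' 2
    have := h3.trans h
    apply hk9
    rw [Int.modEq_iff_dvd]
    omega
  · have hcop : IsCoprime (q ^ 2) 3 :=
      IsCoprime.pow_left (hq.irreducible.coprime_iff_not_dvd.2 hq3)
    have hq2 : ¬ q ^ 2 ∣ k ^ 2 + 3 * k + 9 := by
      intro h
      split_ifs at hD with h3
      · obtain ⟨j, rfl⟩ := h3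
        rw [Int.mul_ediv_cancel_left _ (by norm_num)] at hD
        have h' : q ^ 2 ∣ 3 * (3 * (j ^ 2 + j + 1)) := by convert h using 1; ring
        have := hcop.dvd_of_dvd_mul_left (hcop.dvd_of_dvd_mul_left h')
        exact hq.not_isUnit (hD q (by rwa [← sq]))
      · exact hq.not_isUnit (hD q (by rwa [← sq]))
    have hq3' : ∀ {m : ℤ}, q ∣ 3 * m → q ∣ m := fun h => (hq.dvd_or_dvd h).resolve_left hq3
    obtain ⟨s, t, hst⟩ := hcop
    have hq1 : q ∣ 3 * (t * k) - k := ⟨-(q * s * k), by linear_combination k * hst⟩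
    have hc : q ^ 2 ∣ 3 * (t * k) - k := ⟨-(s * k), by linear_combination k * hst⟩
    generalize t * k = c at hq1 hc
    have key : 27 * (c ^ 3 - k * c ^ 2 - (k + 3) * c - 1) =
        (3 * c - k) * ((3 * c - k) ^ 2 - 3 * (k ^ 2 + 3 * k + 9))
          - (2 * k + 3) * (k ^ 2 + 3 * k + 9) := by ring
    refine ⟨c, hq1, hq3' ?_, hq3' (hq3' (hq3' ?_)), fun h => ?_⟩
    · rw [show 3 * (3 * c ^ 2 - 2 * k * c - (k + 3)) =
        (3 * c - k) * (3 * c - k) - (k ^ 2 + 3 * k + 9) by ring]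
      exact dvd_sub (hq1.mul_right _) hqD
    · rw [show 3 * (3 * (3 * (c ^ 3 - k * c ^ 2 - (k + 3) * c - 1))) =
        27 * (c ^ 3 - k * c ^ 2 - (k + 3) * c - 1) by ring, key]
      exact dvd_sub (hq1.mul_right _) (hqD.mul_left _)
    · have h1 : q ^ 2 ∣ (2 * k + 3) * (k ^ 2 + 3 * k + 9) := by
        have := dvd_sub (hc.mul_right ((3 * c - k) ^ 2 - 3 * (k ^ 2 + 3 * k + 9)))
          (h.mul_left 27)
        rwa [key, sub_sub_cancel] at this
      by_cases hqk : q ∣ 2 * k + 3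
      · have : q ∣ 3 * (3 * 3) := by
          have := dvd_sub (hqD.mul_left 4) (hqk.mul_right (2 * k + 3))
          ring_nf at this ⊢
          exact this
        exact hq3 (hq3' (hq3' this))
      · have h2 : IsCoprime (q ^ 2) (2 * k + 3) :=
          IsCoprime.pow_left (hq.irreducible.coprime_iff_not_dvd.2 hqk)
        exact hq2 (h2.dvd_of_dvd_mul_left h1)

lemma exists_shanks_root {k : ℝ} (hk : 1 ≤ k) :
    ∃ r : ℝ, 7 / 3 < r ∧ r ^ 3 - k * r ^ 2 - (k + 3) * r - 1 = 0 := by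
  have hc : ContinuousOn (fun r : ℝ => r ^ 3 - k * r ^ 2 - (k + 3) * r - 1)
    (Set.Icc (7 / 3) (k + 2)) := by fun_prop
  obtain ⟨r, hr, h⟩ := intermediate_value_Icc (by linarith) hc
    (show (0 : ℝ) ∈ Set.Icc _ _ from ⟨by nlinarith, by nlinarith⟩)
  refine ⟨r, lt_of_le_of_ne hr.1 ?_, h⟩
  rintro rfl
  norm_num at h
  linarith

lemma add_one_lt_pow_of_lt_pow {a : ℝ} {p : ℕ} (hp : 3 ≤ p) (ha : 1 ≤ a) (h : 7 / 3 < a ^ p) :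
    a + 1 < a ^ p := by
  rcases le_or_gt a (4 / 3) with hle | hle
  · linarith
  · have := pow_le_pow_right₀ ha hp
    nlinarith [mul_pos (sub_pos.2 hle) (sub_pos.2 hle),
      mul_pos (mul_pos (sub_pos.2 hle) (sub_pos.2 hle)) (sub_pos.2 hle)]

/-- Three integral combinations of the conjugates of a root of `S_k` cannot simultaneously be
`p`-th roots of them. -/
lemma shanks_no_real_pow {k u v w : ℤ} {p : ℕ} (hp : 3 ≤ p) (hodd : Odd p) {A B C a b c : ℝ}
    (hA : 7 / 3 < A) (hB : B < -1) (hC : -1 < C) (hC0 : C < 0)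
    (h1 : A + B + C = k) (h2 : A * B + B * C + C * A = -(k + 3)) (h3 : A * B * C = 1)
    (ha : a = u + v * A + w * A ^ 2) (hb : b = u + v * B + w * B ^ 2)
    (hc : c = u + v * C + w * C ^ 2) (hap : a ^ p = A) (hbp : b ^ p = B) (hcp : c ^ p = C) :
    False := by
  have ha0 : 0 < a := hodd.pow_pos_iff.1 (by rw [hap]; linarith)
  have ha1 : 1 < a := lt_of_pow_lt_pow_left₀ p ha0.le (by rw [hap, one_pow]; linarith)
  have haA : a + 1 < A := hap ▸ add_one_lt_pow_of_lt_pow hp ha1.le (by linarith)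
  have hb1 : b < -1 := hodd.pow_lt_pow.1 (by rw [hbp, hodd.neg_one_pow]; exact hB)
  have hc1 : -1 < c := hodd.pow_lt_pow.1 (by rw [hcp, hodd.neg_one_pow]; exact hC)
  have hc0 : c < 0 := hodd.pow_neg_iff.1 (by rw [hcp]; exact hC0)
  have hbB : B < b := by
    have := pow_lt_pow_right₀ (a := -b) (by linarith) (show 1 < p by lia)
    rw [hodd.neg_pow, hbp] at this
    linarith
  have hcC : c < C := by
    have := pow_lt_pow_right_of_lt_one₀ (a := -c) (by linarith) (by linarith) (show 1 < p by lia)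
    rw [hodd.neg_pow, hcp] at this
    linarith
  set I : ℤ := (v + w * k) ^ 3 - k * (v + w * k) ^ 2 * w - (k + 3) * (v + w * k) * w ^ 2 - w ^ 3
    with hI
  have hIR : (I : ℝ) = (v + w * (A + B)) * (v + w * (A + C)) * (v + w * (B + C)) := by
    have e : (I : ℝ) = (v + w * k) ^ 3 - k * (v + w * k) ^ 2 * w
      + (-(k + 3)) * (v + w * k) * w ^ 2 - 1 * w ^ 3 := by rw [hI]; push_cast; ring
    rw [e, ← h2, ← h3, ← h1]
    ring
  have hprod : (a - b) * (a - c) * (c - b) = I * ((A - B) * (A - C) * (C - B)) := by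
    rw [hIR, ha, hb, hc]; ring
  have hP : 0 < (A - B) * (A - C) * (C - B) :=
    mul_pos (mul_pos (by linarith) (by linarith)) (by linarith)
  have hp0 : 0 < (a - b) * (a - c) * (c - b) :=
    mul_pos (mul_pos (by linarith) (by linarith)) (by linarith)
  have hlt : (a - b) * (a - c) * (c - b) < (A - B) * (A - C) * (C - B) :=
    mul_lt_mul'' (mul_lt_mul'' (by linarith) (by linarith) (by linarith) (by linarith))
      (by linarith) (mul_nonneg (by linarith) (by linarith)) (by linarith)
  have hI0 : (0 : ℝ) < I := pos_of_mul_pos_left (hprod ▸ hp0) hP.le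
  have hI1 : (1 : ℝ) ≤ I := by exact_mod_cast (Int.cast_pos.1 hI0 : 0 < I)
  nlinarith

section PowerBasis

variable {L : Type*} [Field L] [Algebra ℚ L] {k : ℤ} (pb : PowerBasis ℚ L)

lemma aeval_gen_shanks (h : minpoly ℚ pb.gen = (shanks k).map (algebraMap ℤ ℚ)) :
    aeval pb.gen (shanks k) = 0 := by
  rw [← aeval_map_algebraMap ℚ, ← h, minpoly.aeval]

lemma isIntegral_gen_shanks (h : minpoly ℚ pb.gen = (shanks k).map (algebraMap ℤ ℚ)) :
    IsIntegral ℤ pb.gen :=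
  ⟨shanks k, shanks_monic k, aeval_gen_shanks pb h⟩

/-- The sixth power of `k² + 3k + 9`, a multiple of the discriminant of the power basis, clears
denominators of algebraic integers. -/
lemma shanks_smul_mem_adjoin (h : minpoly ℚ pb.gen = (shanks k).map (algebraMap ℤ ℚ)) {z : L}
    (hz : IsIntegral ℤ z) : (k ^ 2 + 3 * k + 9) ^ 6 • z ∈ Algebra.adjoin ℤ {pb.gen} := by
  have := pb.finite
  have : CharZero L := algebraRat.charZero L
  set x := pb.gen with hx
  have hint : IsIntegral ℤ x := isIntegral_gen_shanks pb h
  have hroot : x ^ 3 - k * x ^ 2 - (k + 3) * x - 1 = 0 := by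
    rw [← aeval_shanks]; exact aeval_gen_shanks pb h
  set A := Algebra.adjoin ℤ {x}
  have hA : ∀ y ∈ A, ∃ n : ℤ, Algebra.norm ℚ y = n := fun y hy => by
    have hy' : IsIntegral ℤ y :=
      Algebra.adjoin_le (S := integralClosure ℤ L) (Set.singleton_subset_iff.2 hint) hy
    obtain ⟨n, hn⟩ := IsIntegrallyClosed.isIntegral_iff.1 (Algebra.isIntegral_norm ℚ hy')
    exact ⟨n, hn.symm⟩
  have hxA : x ∈ A := Algebra.self_mem_adjoin_singleton ℤ x
  have hc (n : ℤ) : (n : L) ∈ A := intCast_mem A n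
  obtain ⟨n, hn⟩ := hA (3 * x ^ 2 - 2 * k * x - (k + 3)) <| by
    have := hc (k + 3)
    push_cast at this
    exact sub_mem (sub_mem (mul_mem (by exact_mod_cast hc 3) (pow_mem hxA 2))
      (mul_mem (mul_mem (by exact_mod_cast hc 2) (hc k)) hxA)) this
  obtain ⟨m, hm⟩ := hA
    (aeval x (X * (1 + X) * (9 - (X - C k - 1) * (3 * X + C k + 3)) ^ 2 : ℤ[X]))
    (aeval_mem_adjoin_singleton ℤ x)
  have hnm : n * m = (k ^ 2 + 3 * k + 9) ^ 6 := by
    have hfin : Module.finrank ℚ L = 3 := by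
      rw [pb.finrank, ← pb.natDegree_minpoly, h, (shanks_monic k).natDegree_map, shanks_natDegree]
    have : (n * m : ℚ) = ((k ^ 2 + 3 * k + 9) ^ 2) ^ 3 := by
      rw [← hn, ← hm, ← map_mul, ← hfin, ← Algebra.norm_algebraMap]
      congr 1
      simp [map_ofNat]
      linear_combination ((2 * x + 1) * (9 - (x - k - 1) * (3 * x + k + 3)) ^ 2 - (3 * x + k + 3) *
        ((x ^ 2 + x + 1) * (9 - (x - k - 1) * (3 * x + k + 3)) + (k ^ 2 + 3 * k + 9))) * hroot
    have h' : (n * m : ℚ) = (k ^ 2 + 3 * k + 9) ^ 6 := by rw [this]; ring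
    exact_mod_cast h'
  have hd := Algebra.discr_mul_isIntegral_mem_adjoin ℚ hint hz
  have hder : aeval x (minpoly ℚ x).derivative = 3 * x ^ 2 - 2 * k * x - (k + 3) := by
    rw [h, derivative_map, aeval_map_algebraMap]
    simp [shanks, map_ofNat]
    ring
  rw [Algebra.discr_powerBasis_eq_norm, hder, hn] at hd
  convert A.smul_mem hd (m * (-1) ^ (Module.finrank ℚ L * (Module.finrank ℚ L - 1) / 2)) using 1
  rw [← Int.cast_smul_eq_zsmul ℚ, ← Int.cast_smul_eq_zsmul ℚ, smul_smul, ← hnm]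
  congr 1
  push_cast
  rw [show ∀ e n m : ℚ, m * e * (e * n) = e * e * (n * m) by intros; ring, ← mul_pow]
  simp

lemma shanks_mem_adjoin_of_smul (h : minpoly ℚ pb.gen = (shanks k).map (algebraMap ℤ ℚ))
    (hk9 : ¬ k ≡ 3 [ZMOD 9])
    (hD : Squarefree (if (3 : ℤ) ∣ k then (k / 3) ^ 2 + k / 3 + 1 else k ^ 2 + 3 * k + 9))
    {q : ℤ} (hq : Prime q) (hqD : q ∣ k ^ 2 + 3 * k + 9) {z : L} (hz : IsIntegral ℤ z)
    (hqz : q • z ∈ Algebra.adjoin ℤ {pb.gen}) : z ∈ Algebra.adjoin ℤ {pb.gen} := by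
  obtain ⟨c, h2, h1, h0, hsq⟩ := shanks_exists_shift hk9 hD hq hqD
  have hint := isIntegral_gen_shanks pb h
  have hintc : IsIntegral ℤ (pb.gen - algebraMap ℤ L c) := hint.sub isIntegral_algebraMap
  have hadj (R : Type) [CommRing R] [Algebra R L] (r : R) :
      Algebra.adjoin R {pb.gen - algebraMap R L r} = Algebra.adjoin R {pb.gen} := by
    apply le_antisymm <;> refine Algebra.adjoin_singleton_le ?_
    · exact sub_mem (Algebra.self_mem_adjoin_singleton R _) (algebraMap_mem _ r)
    · simpa using add_mem (Algebra.self_mem_adjoin_singleton R (pb.gen - algebraMap R L r))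
        (algebraMap_mem _ r)
  have hcast : pb.gen - algebraMap ℤ L c = pb.gen - algebraMap ℚ L c := by simp
  let pb' : PowerBasis ℚ L := PowerBasis.ofAdjoinEqTop (x := pb.gen - algebraMap ℤ L c)
    hintc.tower_top (by rw [hcast, hadj, pb.adjoin_gen_eq_top])
  have hgen : pb'.gen = pb.gen - algebraMap ℤ L c := PowerBasis.ofAdjoinEqTop_gen _ _
  have hmin : minpoly ℤ pb'.gen = (shanks k).comp (X + C c) := by
    apply map_injective (algebraMap ℤ ℚ) (algebraMap ℤ ℚ).injective_int
    rw [hgen, ← minpoly.isIntegrallyClosed_eq_field_fractions' ℚ hintc, hcast,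
      minpoly.sub_algebraMap, h, map_comp]
    simp
  rw [← hadj ℤ c, ← hgen] at hqz ⊢
  exact mem_adjoin_of_smul_prime_smul_of_minpoly_isEisensteinAt hq (hgen ▸ hintc) hz hqz
    (hmin ▸ shanks_comp_eisenstein hq h2 h1 h0 hsq)

/-- Under the squarefreeness hypotheses, `ℤ[ρ]` is integrally closed for `ρ` a root of `S_k`. -/
lemma shanks_mem_adjoin (h : minpoly ℚ pb.gen = (shanks k).map (algebraMap ℤ ℚ))
    (hk9 : ¬ k ≡ 3 [ZMOD 9])
    (hD : Squarefree (if (3 : ℤ) ∣ k then (k / 3) ^ 2 + k / 3 + 1 else k ^ 2 + 3 * k + 9))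
    {z : L} (hz : IsIntegral ℤ z) : z ∈ Algebra.adjoin ℤ {pb.gen} := by
  have peel (n : ℤ) : n ≠ 0 → (∀ q, Prime q → q ∣ n → q ∣ k ^ 2 + 3 * k + 9) →
      ∀ z : L, IsIntegral ℤ z → n • z ∈ Algebra.adjoin ℤ {pb.gen} →
        z ∈ Algebra.adjoin ℤ {pb.gen} := by
    induction n using UniqueFactorizationMonoid.induction_on_prime with
    | h₁ => simp
    | h₂ u hu =>
      rintro - - z - hmem
      rcases Int.isUnit_iff.1 hu with rfl | rfl <;> simpa using hmem
    | h₃ a q ha hq ih =>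
      intro _ hall z hz hmem
      refine ih ha (fun r hr hra => hall r hr (hra.mul_left q)) z hz ?_
      rw [mul_smul] at hmem
      exact shanks_mem_adjoin_of_smul pb h hk9 hD hq (hall q hq (dvd_mul_right q a))
        (hz.smul a) hmem
  exact peel _ (pow_ne_zero 6 (by nlinarith [sq_nonneg (2 * k + 3)]))
    (fun q hq hqn => hq.dvd_of_dvd_pow hqn) z hz (shanks_smul_mem_adjoin pb h hz)

lemma shanks_gen_ne_pow (h : minpoly ℚ pb.gen = (shanks k).map (algebraMap ℤ ℚ)) (hk : 1 ≤ k)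
    (hk9 : ¬ k ≡ 3 [ZMOD 9])
    (hD : Squarefree (if (3 : ℤ) ∣ k then (k / 3) ^ 2 + k / 3 + 1 else k ^ 2 + 3 * k + 9))
    {p : ℕ} (hp : p.Prime) (z : L) : z ^ p ≠ pb.gen := by
  intro hzp
  have hroot := aeval_gen_shanks pb h
  have hzint : IsIntegral ℤ z :=
    IsIntegral.of_pow hp.pos (hzp ▸ isIntegral_gen_shanks pb h)
  obtain ⟨f, hf⟩ : ∃ f : ℤ[X], aeval pb.gen f = z := by
    have := shanks_mem_adjoin pb h hk9 hD hzint
    rwa [Algebra.adjoin_singleton_eq_range_aeval] at this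
  obtain ⟨u, v, w, hz⟩ : ∃ u v w : ℤ, z = u + v * pb.gen + w * pb.gen ^ 2 := by
    have hmod : aeval pb.gen (f %ₘ shanks k) = z := by
      rw [← hf, aeval_modByMonic_eq_self_of_root hroot]
    have hlt : (f %ₘ shanks k).natDegree < 3 := by
      rw [← shanks_natDegree k]
      refine natDegree_modByMonic_lt f (shanks_monic k) fun h1 => ?_
      simpa [h1] using shanks_natDegree k
    refine ⟨(f %ₘ shanks k).coeff 0, (f %ₘ shanks k).coeff 1, (f %ₘ shanks k).coeff 2, ?_⟩
    rw [← hmod, aeval_eq_sum_range' hlt]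
    simp [Finset.sum_range_succ]
  have hemb (r : ℝ) (hr : r ^ 3 - k * r ^ 2 - (k + 3) * r - 1 = 0) :
      ∃ a : ℝ, a = u + v * r + w * r ^ 2 ∧ a ^ p = r := by
    have hr' : aeval r (minpoly ℚ pb.gen) = 0 := by
      rw [h, aeval_map_algebraMap, aeval_shanks, hr]
    refine ⟨pb.lift r hr' z, ?_, ?_⟩
    · simp [hz]
    · rw [← map_pow, hzp, pb.lift_gen]
  have hkR : (1 : ℝ) ≤ k := by exact_mod_cast hk
  obtain ⟨A, hA, hAr⟩ := exists_shanks_root hkR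
  have hA0 : A ≠ 0 := by linarith
  have hA1 : 1 + A ≠ 0 := by linarith
  have hkA : (k : ℝ) * (A * (1 + A)) = A ^ 3 - 3 * A - 1 := by linear_combination -hAr
  obtain ⟨B, hB⟩ : ∃ B, B = -(1 + A) / A := ⟨_, rfl⟩
  obtain ⟨C, hC⟩ : ∃ C, C = -1 / (1 + A) := ⟨_, rfl⟩
  have hk' : (k : ℝ) = (A ^ 3 - 3 * A - 1) / (A * (1 + A)) := by
    rw [eq_div_iff (mul_ne_zero hA0 hA1), hkA]
  have hBr : B ^ 3 - k * B ^ 2 - (k + 3) * B - 1 = 0 := by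
    rw [hk', hB]; field_simp; ring
  have hCr : C ^ 3 - k * C ^ 2 - (k + 3) * C - 1 = 0 := by
    rw [hk', hC]; field_simp; ring
  have hB1 : B < -1 := by
    rw [hB, div_lt_iff₀ (by linarith)]; linarith
  have hC1 : -1 < C := by
    rw [hC, lt_div_iff₀ (by linarith)]; linarith
  have hC0 : C < 0 := by
    rw [hC]; exact div_neg_of_neg_of_pos (by norm_num) (by linarith)
  obtain ⟨a, ha, hap⟩ := hemb A hAr
  obtain ⟨b, hb, hbp⟩ := hemb B hBr
  obtain ⟨c, hc, hcp⟩ := hemb C hCr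
  rcases hp.eq_two_or_odd' with rfl | hodd
  · nlinarith [sq_nonneg b]
  · have hp3 : 3 ≤ p := by
      have := hp.two_le
      obtain ⟨t, rfl⟩ := hodd
      lia
    refine shanks_no_real_pow (k := k) hp3 hodd hA hB1 hC1 hC0 ?_ ?_ ?_ ha hb hc hap hbp hcp
    · rw [hk', hB, hC]; field_simp; ring
    · rw [hk', hB, hC]; field_simp; ring
    · rw [hB, hC]; field_simp

end PowerBasis

/-- Let `k ≥ 1` with `k ≢ 3 (mod 9)` be such that `D` is
squarefree, where `D = (k/3)² + k/3 + 1` if `3 ∣ k` and `D = k² + 3k + 9`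
otherwise, and let `p` be a prime.  Then the power-compositional polynomial
`S_k(x^p) = x^{3p} − k·x^{2p} − (k+3)·x^p − 1` is irreducible over `ℚ`. -/
theorem shanks_power_irreducible (k : ℤ) (hk : 1 ≤ k) (hk9 : ¬ k ≡ 3 [ZMOD 9])
    (hD : Squarefree (if (3 : ℤ) ∣ k then (k / 3) ^ 2 + k / 3 + 1 else k ^ 2 + 3 * k + 9))
    (p : ℕ) (hp : p.Prime) :
    Irreducible (X ^ (3 * p) - C (k : ℚ) * X ^ (2 * p) - C ((k : ℚ) + 3) * X ^ p - 1) := by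
  have hcomp : (X ^ (3 * p) - C (k : ℚ) * X ^ (2 * p) - C ((k : ℚ) + 3) * X ^ p - 1) =
      ((shanks k).map (algebraMap ℤ ℚ)).comp (X ^ p) := by
    simp [shanks, ← pow_mul, mul_comp, mul_comm p,
      show (Polynomial.C 3 : ℚ[X]) = 3 from rfl]
  rw [hcomp]
  refine irreducible_comp ((shanks_monic k).map _) (monic_X_pow p)
    ((shanks_monic k).irreducible_iff_irreducible_map_fraction_map.1 (shanks_irreducible k)) ?_
  intro E _ _ x hx
  have hxint : IsIntegral ℚ x := by
    by_contra hn
    rw [minpoly.eq_zero hn] at hx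
    exact ((shanks_monic k).map (algebraMap ℤ ℚ)).ne_zero hx.symm
  rw [Polynomial.map_pow, map_X]
  refine X_pow_sub_C_irreducible_of_prime hp fun b => ?_
  have := @shanks_gen_ne_pow _ _ (IntermediateField.adjoin ℚ {x}).algebra' k
    (IntermediateField.adjoin.powerBasis hxint)
    (by rw [IntermediateField.adjoin.powerBasis_gen, IntermediateField.minpoly_gen, hx])
    hk hk9 hD p hp b
  rwa [IntermediateField.adjoin.powerBasis_gen] at this
end

section
/- Let k ≥ 1 be an integer, let p be a prime, let θ be a root of the irreducible polynomial S_k(x^p), and let L = ℚ(θ), a number field of degree 3p. Then the discriminant of the power basis {1, θ, θ², ..., θ^{3p−1}} of L over ℚ (equivalently, the discriminant of the polynomial S_k(x^p)) equals (−1)^{(p−2)(p−1)/2} · p^{3p} · (k² + 3k + 9)^{2p}. -/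
open Polynomial IntermediateField

/-- The norm of `g(x)`, for `x` a generator of `L / K`, is the resultant of the minimal polynomial
of `x` with `g`. -/
theorem PowerBasis.norm_aeval_gen_eq_resultant {K L : Type*} [Field K] [Field L] [Algebra K L]
    [Algebra.IsSeparable K L] (pb : PowerBasis K L) (g : K[X]) (n : ℕ) (hg : g.natDegree ≤ n) :
    Algebra.norm K (aeval pb.gen g) =
      resultant (minpoly K pb.gen) g (minpoly K pb.gen).natDegree n := by
  classical
  have := pb.finite
  let E := AlgebraicClosure K
  have hsplit : ((minpoly K pb.gen).map (algebraMap K E)).Splits := IsAlgClosed.splits _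
  have hmonic := (minpoly.monic pb.isIntegral_gen).map (algebraMap K E)
  have hnodup : ((minpoly K pb.gen).aroots E).Nodup :=
    nodup_roots (Separable.map (Algebra.IsSeparable.isSeparable K pb.gen))
  apply (algebraMap K E).injective
  rw [← resultant_map_map, ← natDegree_map (algebraMap K E),
    resultant_eq_prod_eval _ _ _ (natDegree_map_le.trans hg) hsplit, hmonic.leadingCoeff, one_pow,
    one_mul, Algebra.norm_eq_prod_embeddings K E]
  rw [Fintype.prod_equiv pb.liftEquiv' _
    (fun x => (g.map (algebraMap K E)).eval (x : E)) ?_]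
  · rw [Finset.prod_mem_multiset (g := fun x => (g.map (algebraMap K E)).eval x)
      (hfg := fun _ => rfl), Finset.prod_eq_multiset_prod, Multiset.toFinset_val,
      Multiset.dedup_eq_self.mpr hnodup]
  · intro σ
    rw [PowerBasis.liftEquiv'_apply_coe, eval_map_algebraMap, aeval_algHom_apply]

/-- The norm of `g(x)` from a finite separable extension `L / K` is a power of the resultant of the
minimal polynomial of `x` with `g`. -/
theorem Algebra.norm_aeval_eq_resultant_pow {K L : Type*} [Field K] [Field L] [Algebra K L]
    [FiniteDimensional K L] [Algebra.IsSeparable K L] (x : L) (g : K[X]) (n : ℕ)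
    (hg : g.natDegree ≤ n) :
    Algebra.norm K (aeval x g) =
      resultant (minpoly K x) g (minpoly K x).natDegree n ^ Module.finrank K⟮x⟯ L := by
  have hx : IsIntegral K x := .of_finite K x
  have h := (IntermediateField.adjoin.powerBasis hx).norm_aeval_gen_eq_resultant g n hg
  rw [IntermediateField.adjoin.powerBasis_gen, minpoly_gen] at h
  rw [← h, ← map_pow, ← Algebra.norm_algebraMap, Algebra.norm_norm, ← aeval_algebraMap_apply,
    AdjoinSimple.algebraMap_gen]

/-- The discriminant of the family of powers of a generator `θ` of a separable extension. -/
theorem Algebra.discr_pow_eq_norm {K L : Type*} [Field K] [Field L] [Algebra K L]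
    [FiniteDimensional K L] [Algebra.IsSeparable K L] {θ : L} (hθ : K⟮θ⟯ = ⊤) {n : ℕ}
    (hn : (minpoly K θ).natDegree = n) :
    Algebra.discr K (fun i : Fin n => θ ^ (i : ℕ)) =
      (-1) ^ (n * (n - 1) / 2) * Algebra.norm K (aeval θ (derivative (minpoly K θ))) := by
  have hint : IsIntegral K θ := .of_finite K θ
  have htop : Algebra.adjoin K {θ} = ⊤ := by
    rw [← adjoin_simple_toSubalgebra_of_isAlgebraic hint.isAlgebraic, hθ, top_toSubalgebra]
  have hgen := PowerBasis.ofAdjoinEqTop_gen hint htop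
  have hdim := (PowerBasis.ofAdjoinEqTop hint htop).natDegree_minpoly
  generalize PowerBasis.ofAdjoinEqTop hint htop = pb at hgen hdim
  subst hgen
  obtain rfl : pb.dim = n := hdim.symm.trans hn
  rw [← pb.coe_basis, Algebra.discr_powerBasis_eq_norm, pb.finrank]

/-- The norm of a generator `θ` of a finite extension. -/
theorem Algebra.norm_eq_coeff_zero_minpoly {K L : Type*} [Field K] [Field L] [Algebra K L]
    [FiniteDimensional K L] {θ : L} (hθ : K⟮θ⟯ = ⊤) :
    Algebra.norm K θ = (-1) ^ (minpoly K θ).natDegree * (minpoly K θ).coeff 0 := by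
  have hint : IsIntegral K θ := .of_finite K θ
  have htop : Algebra.adjoin K {θ} = ⊤ := by
    rw [← adjoin_simple_toSubalgebra_of_isAlgebraic hint.isAlgebraic, hθ, top_toSubalgebra]
  have h := PowerBasis.norm_gen_eq_coeff_zero_minpoly (PowerBasis.ofAdjoinEqTop hint htop)
  rwa [← PowerBasis.natDegree_minpoly, PowerBasis.ofAdjoinEqTop_gen] at h

/-- The Shanks polynomial `x³ - k x² - (k + 3) x - 1`. -/
noncomputable def shanksPoly {R : Type*} [CommRing R] (k : R) : R[X] :=
  X ^ 3 - C k * X ^ 2 - C (k + 3) * X - 1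

section shanksPoly

variable {R : Type*} [CommRing R] (k : R)

theorem natDegree_shanksPoly [Nontrivial R] : (shanksPoly k).natDegree = 3 := by
  unfold shanksPoly
  compute_degree!

theorem monic_shanksPoly : (shanksPoly k).Monic := by
  unfold shanksPoly
  monicity!

theorem derivative_shanksPoly :
    derivative (shanksPoly k) = C 3 * X ^ 2 - C (2 * k) * X - C (k + 3) := by
  simp only [shanksPoly, derivative_sub, derivative_X_pow, derivative_C_mul, derivative_X,
    derivative_one, C_mul, mul_one, sub_zero]
  simp
  ring

theorem natDegree_derivative_shanksPoly_le : (derivative (shanksPoly k)).natDegree ≤ 2 := by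
  rw [derivative_shanksPoly]
  compute_degree

theorem discr_shanksPoly [Nontrivial R] :
    (shanksPoly k).discr = (k ^ 2 + 3 * k + 9) ^ 2 := by
  have hdeg : (shanksPoly k).degree = 3 := by
    rw [degree_eq_natDegree (monic_shanksPoly k).ne_zero, natDegree_shanksPoly]; rfl
  rw [discr_of_degree_eq_three hdeg]
  have h0 : (shanksPoly k).coeff 0 = -1 := by simp [shanksPoly]
  have h1 : (shanksPoly k).coeff 1 = -(k + 3) := by
    simp [shanksPoly, coeff_one, coeff_X_pow, -map_add]
  have h2 : (shanksPoly k).coeff 2 = -k := by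
    simp [shanksPoly, coeff_one, coeff_X_pow, -map_add]
  have h3 : (shanksPoly k).coeff 3 = 1 := by
    simp [shanksPoly, coeff_one, coeff_X_pow, -map_add]
  rw [h0, h1, h2, h3]
  ring

theorem resultant_shanksPoly_derivative [Nontrivial R] :
    resultant (shanksPoly k) (derivative (shanksPoly k)) 3 2 = -(k ^ 2 + 3 * k + 9) ^ 2 := by
  have h := resultant_deriv (f := shanksPoly k)
    (natDegree_pos_iff_degree_pos.mp (by rw [natDegree_shanksPoly]; norm_num))
  rw [natDegree_shanksPoly, (monic_shanksPoly k).leadingCoeff, discr_shanksPoly] at h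
  rw [h]
  norm_num

theorem expand_shanksPoly (p : ℕ) :
    expand R p (shanksPoly k) = X ^ (3 * p) - C k * X ^ (2 * p) - C (k + 3) * X ^ p - 1 := by
  simp only [shanksPoly, map_sub, map_mul, map_pow, expand_X, expand_C, map_one, ← pow_mul]
  simp only [mul_comm p]

end shanksPoly

/-- The signs arising in the discriminant of a cubic in `x ^ p` combine to the stated one. -/
theorem neg_one_pow_shanks_sign {R : Type*} [CommRing R] {p : ℕ} (hp : p.Prime) :
    (-1 : R) ^ (3 * p * (3 * p - 1) / 2) * (((-1) ^ (3 * p + 1)) ^ (p - 1) * (-1) ^ p) =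
      (-1) ^ ((p - 2) * (p - 1) / 2) := by
  rcases hp.eq_two_or_odd' with rfl | ⟨m, rfl⟩
  · norm_num
  · have h1 : 3 * (2 * m + 1) * (3 * (2 * m + 1) - 1) / 2 = 18 * m ^ 2 + 15 * m + 3 := by
      rw [show 3 * (2 * m + 1) - 1 = 6 * m + 2 by lia]
      exact Nat.div_eq_of_eq_mul_left two_pos (by ring)
    obtain ⟨n, rfl⟩ : ∃ n, m = n + 1 := Nat.exists_eq_add_one.mpr (by
      by_contra! h
      obtain rfl : m = 0 := by lia
      exact Nat.not_prime_one hp)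
    have h2 : (2 * (n + 1) + 1 - 2) * (2 * (n + 1) + 1 - 1) / 2 = 2 * n ^ 2 + 3 * n + 1 := by
      rw [show 2 * (n + 1) + 1 - 2 = 2 * n + 1 by lia,
        show 2 * (n + 1) + 1 - 1 = 2 * n + 2 by lia]
      exact Nat.div_eq_of_eq_mul_left two_pos (by ring)
    rw [h1, h2, ← pow_mul, ← pow_add, ← pow_add]
    apply neg_one_pow_congr
    simp only [Nat.add_sub_cancel]
    grind

/-- If `θ` generates `L / K` and is a root of the irreducible polynomial `S(x ^ p)` with `S` monic,
then `S` is the minimal polynomial of `θ ^ p`, and `L` has degree `p` over `K(θ ^ p)`. -/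
theorem minpoly_pow_and_finrank_of_irreducible_expand {K L : Type*} [Field K] [Field L]
    [Algebra K L] [FiniteDimensional K L] {S : K[X]} (hS : S.Monic) {p : ℕ} (hp : p ≠ 0)
    (hirr : Irreducible (expand K p S)) {θ : L} (hθ : aeval θ (expand K p S) = 0)
    (hgen : K⟮θ⟯ = ⊤) :
    minpoly K θ = expand K p S ∧ minpoly K (θ ^ p) = S ∧ Module.finrank K⟮θ ^ p⟯ L = p := by
  have hθmin : minpoly K θ = expand K p S :=
    (minpoly.eq_of_irreducible_of_monic hirr hθ (hS.expand hp.bot_lt)).symm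
  have hαmin : minpoly K (θ ^ p) = S :=
    (minpoly.eq_of_irreducible_of_monic (of_irreducible_expand hp hirr)
      (by rwa [expand_aeval] at hθ) hS).symm
  refine ⟨hθmin, hαmin, ?_⟩
  have htower := Module.finrank_mul_finrank K K⟮θ ^ p⟯ L
  rw [adjoin.finrank (.of_finite K _), hαmin,
    ← (Field.primitive_element_iff_minpoly_natDegree_eq K θ).mp hgen, hθmin, natDegree_expand] at htower
  exact Nat.eq_of_mul_eq_mul_left (of_irreducible_expand hp hirr).natDegree_pos htower

/-- Let `k ≥ 1`, `p` prime, `θ` a root of the irreducible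
polynomial `S_k(x^p) = x^{3p} − k·x^{2p} − (k+3)·x^p − 1`, and `L = ℚ(θ)`, a
number field of degree `3p`.  Then the discriminant of the power basis
`{1, θ, …, θ^{3p−1}}` of `L` over `ℚ` equals
`(−1)^{(p−2)(p−1)/2} · p^{3p} · (k² + 3k + 9)^{2p}`. -/
theorem shanks_power_discr (k : ℤ) (hk : 1 ≤ k) (p : ℕ) (hp : p.Prime)
    (hirr : Irreducible (X ^ (3 * p) - C (k : ℚ) * X ^ (2 * p) - C ((k : ℚ) + 3) * X ^ p - 1))
    (L : Type*) [Field L] [NumberField L] (θ : L)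
    (hθ : θ ^ (3 * p) - (k : L) * θ ^ (2 * p) - ((k : L) + 3) * θ ^ p - 1 = 0)
    (hgen : ℚ⟮θ⟯ = ⊤) :
    Algebra.discr ℚ (fun i : Fin (3 * p) => θ ^ (i : ℕ)) =
      (-1 : ℚ) ^ ((p - 2) * (p - 1) / 2) * (p : ℚ) ^ (3 * p) *
        ((k : ℚ) ^ 2 + 3 * k + 9) ^ (2 * p) := by
  have hp0 := hp.ne_zero
  have hexp := expand_shanksPoly (k : ℚ) p
  rw [← hexp] at hirr
  have hroot : aeval θ (expand ℚ p (shanksPoly (k : ℚ))) = 0 := by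
    rw [hexp]
    simpa using hθ
  obtain ⟨hθmin, hαmin, hrank⟩ := minpoly_pow_and_finrank_of_irreducible_expand
    (monic_shanksPoly (k : ℚ)) hp0 hirr hroot hgen
  have hdeg : (minpoly ℚ θ).natDegree = 3 * p := by
    rw [hθmin, natDegree_expand, natDegree_shanksPoly]
  have hfin : Module.finrank ℚ L = 3 * p := by
    rw [← (Field.primitive_element_iff_minpoly_natDegree_eq ℚ θ).mp hgen, hdeg]
  have hcoeff : (minpoly ℚ θ).coeff 0 = -1 := by
    rw [hθmin, coeff_zero_eq_eval_zero, expand_eval, zero_pow hp0]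
    simp [shanksPoly]
  have hnormθ : Algebra.norm ℚ θ = (-1) ^ (3 * p + 1) := by
    rw [Algebra.norm_eq_coeff_zero_minpoly hgen, hdeg, hcoeff, pow_succ]
  have hnormα : Algebra.norm ℚ (aeval (θ ^ p) (derivative (shanksPoly (k : ℚ)))) =
      (-1) ^ p * ((k : ℚ) ^ 2 + 3 * k + 9) ^ (2 * p) := by
    rw [Algebra.norm_aeval_eq_resultant_pow _ _ 2 (natDegree_derivative_shanksPoly_le _), hrank,
      hαmin, natDegree_shanksPoly, resultant_shanksPoly_derivative, neg_pow, ← pow_mul]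
  have hderiv : aeval θ (derivative (minpoly ℚ θ)) =
      aeval (θ ^ p) (derivative (shanksPoly (k : ℚ))) * ((p : L) * θ ^ (p - 1)) := by
    rw [hθmin, derivative_expand, map_mul, expand_aeval]
    simp
  rw [Algebra.discr_pow_eq_norm hgen hdeg, hderiv, map_mul, map_mul, map_pow, hnormα, hnormθ,
    Algebra.norm_natCast, hfin, ← neg_one_pow_shanks_sign hp]
  ring
end

section
/- Let k ≥ 1 be an integer and let p be a prime such that S_k(x) is irreducible in 𝔽_p[x]. Then π(p) divides p² + p + 1. -/
open Polynomial

/-- The sequence `U₀ = U₁ = 0`, `U₂ = 1`,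
`U_n = k·U_{n−1} + (k+3)·U_{n−2} + U_{n−3}` for `n ≥ 3`. -/
def shanksSeq (k : ℤ) : ℕ → ℤ
  | 0 => 0
  | 1 => 0
  | 2 => 1
  | n + 3 => k * shanksSeq k (n + 2) + (k + 3) * shanksSeq k (n + 1) + shanksSeq k n

/-- `π(m)`: the least period of the sequence `(U_n)` modulo `m`. -/
noncomputable def shanksPeriod (k : ℤ) (m : ℕ) : ℕ :=
  sInf {n : ℕ | 0 < n ∧ ∀ j : ℕ, (shanksSeq k (j + n) : ZMod m) = (shanksSeq k j : ZMod m)}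

/-- The least positive period of a sequence divides every positive period. -/
theorem Function.Periodic.sInf_dvd {α : Type*} {f : ℕ → α} {n : ℕ} (hn : 0 < n)
    (hf : Function.Periodic f n) : sInf {m : ℕ | 0 < m ∧ Function.Periodic f m} ∣ n := by
  set d := sInf {m : ℕ | 0 < m ∧ Function.Periodic f m}
  obtain ⟨hd0, hfd⟩ : 0 < d ∧ Function.Periodic f d :=
    Nat.sInf_mem (s := {m : ℕ | 0 < m ∧ Function.Periodic f m}) ⟨n, hn, hf⟩
  refine Nat.dvd_of_mod_eq_zero (Nat.eq_zero_of_not_pos fun hr => ?_)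
  refine (Nat.mod_lt n hd0).not_ge (Nat.sInf_le ⟨hr, fun j => ?_⟩)
  rw [← hfd.nat_mul (n / d) (j + n % d), Nat.cast_id, add_assoc, mul_comm, Nat.mod_add_div, hf j]

/-- Powers of a root of the Shanks polynomial, in terms of the sequence `U`. -/
theorem pow_succ_eq_shanksSeq {R : Type*} [CommRing R] (k : ℤ) {a : R}
    (ha : a ^ 3 = k * a ^ 2 + (k + 3) * a + 1) (n : ℕ) :
    a ^ (n + 1) = shanksSeq k (n + 1) * a ^ 2 +
      (shanksSeq k (n + 2) - k * shanksSeq k (n + 1)) * a + shanksSeq k n := by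
  induction n with
  | zero => simp [shanksSeq]
  | succ n ih =>
    rw [pow_succ, ih]
    simp only [shanksSeq]
    push_cast
    linear_combination (shanksSeq k (n + 1) : R) * ha

/-- A root of an irreducible monic cubic with constant coefficient `-1` over a field with `q`
elements has order dividing `q ^ 2 + q + 1`. -/
theorem AdjoinRoot.root_pow_eq_one_of_cubic {F : Type*} [Field F] [Finite F] {f : F[X]}
    (hf : Irreducible f) (hmonic : f.Monic) (hdeg : f.natDegree = 3) (h0 : f.coeff 0 = -1) :
    AdjoinRoot.root f ^ (Nat.card F ^ 2 + Nat.card F + 1) = 1 := by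
  have : Fact (Irreducible f) := ⟨hf⟩
  have : FiniteDimensional F (AdjoinRoot f) := hmonic.finite_adjoinRoot
  have : Finite (AdjoinRoot f) := Module.finite_of_finite F
  have hrank : Module.finrank F (AdjoinRoot f) = 3 := by
    rw [(AdjoinRoot.powerBasis hf.ne_zero).finrank, AdjoinRoot.powerBasis_dim, hdeg]
  have hnorm : Algebra.norm F (AdjoinRoot.root f) = 1 := by
    have h := Algebra.PowerBasis.norm_gen_eq_coeff_zero_minpoly (AdjoinRoot.powerBasis hf.ne_zero)
    rw [AdjoinRoot.minpoly_powerBasis_gen_of_monic hmonic, AdjoinRoot.powerBasis_gen,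
      AdjoinRoot.powerBasis_dim, hdeg, h0] at h
    rw [h]
    norm_num
  have h := FiniteField.algebraMap_norm_eq_pow_sum F (AdjoinRoot f) (AdjoinRoot.root f)
  rw [hnorm, map_one, hrank] at h
  rw [h]
  congr 1
  simp only [Finset.sum_range_succ, Finset.sum_range_zero]
  ring

/-- Let `k ≥ 1` and let `p` be a prime such that the Shanks
polynomial `S_k(x) = x³ − k·x² − (k+3)·x − 1` is irreducible in `𝔽_p[x]`.
Then `π(p)` divides `p² + p + 1`. -/
theorem shanks_period_dvd (k : ℤ) (hk : 1 ≤ k) (p : ℕ) (hp : p.Prime)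
    (hirr : Irreducible (X ^ 3 - C (k : ZMod p) * X ^ 2 - C ((k : ZMod p) + 3) * X - 1)) :
    shanksPeriod k p ∣ p ^ 2 + p + 1 := by
  have : Fact p.Prime := ⟨hp⟩
  set f : (ZMod p)[X] := X ^ 3 - C (k : ZMod p) * X ^ 2 - C ((k : ZMod p) + 3) * X - 1 with hf
  have hdeg : f.natDegree = 3 := by rw [hf]; compute_degree!
  have hmonic : f.Monic := by rw [hf]; monicity!
  have hpow := AdjoinRoot.root_pow_eq_one_of_cubic hirr hmonic hdeg (by simp [hf])
  rw [Nat.card_zmod] at hpow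
  have hroot : AdjoinRoot.root f ^ 3 =
      k * AdjoinRoot.root f ^ 2 + (k + 3) * AdjoinRoot.root f + 1 := by
    have h := (congrArg (AdjoinRoot.mk f) hf).symm.trans AdjoinRoot.mk_self
    simp only [map_sub, map_add, map_mul, map_pow, map_one, AdjoinRoot.mk_X, map_intCast,
      map_ofNat] at h
    linear_combination h
  refine Function.Periodic.sInf_dvd (f := fun j => (shanksSeq k j : ZMod p)) (by positivity)
    fun j => ?_
  set N := p ^ 2 + p + 1
  set U : ℕ → (ZMod p)[X] := fun n => C (shanksSeq k n : ZMod p) with hU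
  set g : ℕ → (ZMod p)[X] := fun n =>
    U (n + 1) * X ^ 2 + (U (n + 2) - C (k : ZMod p) * U (n + 1)) * X + U n with hg
  have hmk (n : ℕ) : AdjoinRoot.mk f (g n) = AdjoinRoot.root f ^ (n + 1) := by
    rw [pow_succ_eq_shanksSeq k hroot n]
    simp [hg, hU]
  have hdvd : f ∣ g (j + N) - g j := by
    rw [← AdjoinRoot.mk_eq_mk, hmk, hmk, add_right_comm, pow_add, hpow, mul_one]
  have hlt : (g (j + N) - g j).degree < f.degree := by
    rw [degree_eq_natDegree hirr.ne_zero, hdeg]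
    refine lt_of_le_of_lt (b := ((2 : ℕ) : WithBot ℕ)) ?_ (by norm_num)
    simp only [hg, hU]
    compute_degree
    exact le_rfl
  have hzero := congrArg (fun q => coeff q 0) (eq_zero_of_dvd_of_degree_lt hdvd hlt)
  simpa [hg, hU, sub_eq_zero] using hzero
end

section
/- Let k ≥ 1 be an integer and let p be a prime such that S_k(x) is irreducible in 𝔽_p[x]. Then either π(p²) = π(p) or π(p²) = p·π(p). -/
open Polynomial

/-- The left shift on sequences. -/
def seqShift {α : Type*} (f : ℕ → α) : ℕ → α := fun j => f (j + 1)

theorem seqShift_iterate {α : Type*} (n : ℕ) (f : ℕ → α) :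
    seqShift^[n] f = fun j => f (j + n) := by
  induction n generalizing f with
  | zero => rfl
  | succ n ih =>
    rw [Function.iterate_succ_apply, ih]
    funext j
    exact congrArg f (by omega)

/-- The Shanks sequence modulo `m`. -/
def shanksSeqMod (k : ℤ) (m : ℕ) : ℕ → ZMod m := fun j => (shanksSeq k j : ZMod m)

theorem isPeriodicPt_shanksSeqMod_iff (k : ℤ) (m n : ℕ) :
    Function.IsPeriodicPt seqShift n (shanksSeqMod k m) ↔
      ∀ j, (m : ℤ) ∣ shanksSeq k (j + n) - shanksSeq k j := by
  rw [Function.IsPeriodicPt, Function.IsFixedPt, seqShift_iterate, funext_iff]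
  refine forall_congr' fun j => ?_
  rw [← ZMod.intCast_zmod_eq_zero_iff_dvd, Int.cast_sub, sub_eq_zero]
  rfl

theorem shanksPeriod_eq_minimalPeriod (k : ℤ) (m : ℕ) :
    shanksPeriod k m = Function.minimalPeriod seqShift (shanksSeqMod k m) := by
  have hset : {n : ℕ | 0 < n ∧
      ∀ j : ℕ, (shanksSeq k (j + n) : ZMod m) = (shanksSeq k j : ZMod m)} =
      {n : ℕ | 0 < n ∧ Function.IsPeriodicPt seqShift n (shanksSeqMod k m)} := by
    ext n
    rw [Set.mem_ofPred_eq, Set.mem_ofPred_eq, Function.IsPeriodicPt, Function.IsFixedPt,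
      seqShift_iterate, funext_iff]
    rfl
  rw [shanksPeriod, hset]
  rcases Set.eq_empty_or_nonempty
    {n : ℕ | 0 < n ∧ Function.IsPeriodicPt seqShift n (shanksSeqMod k m)} with h | h
  · rw [h, Nat.sInf_empty, eq_comm, Function.minimalPeriod_eq_zero_iff_notMem_periodicPts]
    rintro ⟨n, hn⟩
    exact (h ▸ (show n ∈ {n : ℕ | 0 < n ∧ _} from hn) : n ∈ (∅ : Set ℕ))
  · obtain ⟨hpos, hper⟩ := Nat.sInf_mem h
    refine le_antisymm (Nat.sInf_le ⟨?_, Function.isPeriodicPt_minimalPeriod _ _⟩)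
      (hper.minimalPeriod_le hpos)
    exact hper.minimalPeriod_pos hpos

/-- Every solution of the recurrence is an integral combination of shifts of the Shanks
sequence. -/
theorem eq_combination_shanksSeq (k : ℤ) (W : ℕ → ℤ)
    (hW : ∀ j, W (j + 3) = k * W (j + 2) + (k + 3) * W (j + 1) + W j) (j : ℕ) :
    W j = W 0 * shanksSeq k (j + 2) + (W 1 - k * W 0) * shanksSeq k (j + 1) +
      (W 2 - k * W 1 - (k + 3) * W 0) * shanksSeq k j := by
  induction j using Nat.strong_induction_on with
  | _ j ih =>
    match j with
    | 0 => simp [shanksSeq]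
    | 1 => simp [shanksSeq]; ring
    | 2 => simp [shanksSeq]; ring
    | j + 3 =>
      rw [hW, ih j (by omega), ih (j + 1) (by omega), ih (j + 2) (by omega)]
      simp only [shanksSeq]
      ring

theorem sq_dvd_shanksSeq_sub (k m : ℤ) (n : ℕ)
    (h : ∀ j, m ∣ shanksSeq k (j + n) - shanksSeq k j) (i : ℕ) (j : ℕ) (hi : m ∣ i) :
    m ^ 2 ∣ shanksSeq k (j + i * n) - shanksSeq k j := by
  rcases eq_or_ne m 0 with rfl | hm
  · obtain rfl : i = 0 := by simpa using hi
    simp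
  choose W hW using h
  have hrec : ∀ j, W (j + 3) = k * W (j + 2) + (k + 3) * W (j + 1) + W j := by
    intro j
    apply mul_left_cancel₀ hm
    have e : shanksSeq k (j + 3 + n) = k * shanksSeq k (j + 2 + n) +
        (k + 3) * shanksSeq k (j + 1 + n) + shanksSeq k (j + n) := by
      rw [show j + 3 + n = j + n + 3 by omega, show j + 2 + n = j + n + 2 by omega,
        show j + 1 + n = j + n + 1 by omega, shanksSeq]
    have e' : shanksSeq k (j + 3) = k * shanksSeq k (j + 2) +
        (k + 3) * shanksSeq k (j + 1) + shanksSeq k j := by rw [shanksSeq]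
    linear_combination e - e' - hW (j + 3) + k * hW (j + 2) + (k + 3) * hW (j + 1) + hW j
  have hWper : ∀ j, m ∣ W (j + n) - W j := by
    intro j
    rw [eq_combination_shanksSeq k W hrec (j + n), eq_combination_shanksSeq k W hrec j,
      show j + n + 2 = j + 2 + n by omega, show j + n + 1 = j + 1 + n by omega]
    refine ⟨W 0 * W (j + 2) + (W 1 - k * W 0) * W (j + 1) +
      (W 2 - k * W 1 - (k + 3) * W 0) * W j, ?_⟩
    linear_combination W 0 * hW (j + 2) + (W 1 - k * W 0) * hW (j + 1) +
      (W 2 - k * W 1 - (k + 3) * W 0) * hW j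
  have key : ∀ i j : ℕ, m ^ 2 ∣ shanksSeq k (j + i * n) - shanksSeq k j - i * m * W j := by
    intro i
    induction i with
    | zero => simp
    | succ i ih =>
      intro j
      obtain ⟨a, ha⟩ := ih (j + n)
      obtain ⟨b, hb⟩ := hWper j
      refine ⟨a + i * b, ?_⟩
      rw [show j + (i + 1) * n = j + n + i * n by ring]
      push_cast
      linear_combination ha + hW j + i * m * hb
  obtain ⟨a, ha⟩ := key i j
  obtain ⟨c, hc⟩ := hi
  exact ⟨a + c * W j, by linear_combination ha + m * W j * hc⟩

/-- Let `k ≥ 1` and let `p` be a prime such that the Shanks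
polynomial `S_k(x) = x³ − k·x² − (k+3)·x − 1` is irreducible in `𝔽_p[x]`.
Then either `π(p²) = π(p)` or `π(p²) = p·π(p)`. -/
theorem shanks_period_sq (k : ℤ) (hk : 1 ≤ k) (p : ℕ) (hp : p.Prime)
    (hirr : Irreducible (X ^ 3 - C (k : ZMod p) * X ^ 2 - C ((k : ZMod p) + 3) * X - 1)) :
    shanksPeriod k (p ^ 2) = shanksPeriod k p ∨
      shanksPeriod k (p ^ 2) = p * shanksPeriod k p := by
  rw [shanksPeriod_eq_minimalPeriod, shanksPeriod_eq_minimalPeriod]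
  set a := Function.minimalPeriod seqShift (shanksSeqMod k p) with ha
  set b := Function.minimalPeriod seqShift (shanksSeqMod k (p ^ 2)) with hb
  have hab : a ∣ b := by
    refine Function.IsPeriodicPt.minimalPeriod_dvd ?_
    rw [isPeriodicPt_shanksSeqMod_iff]
    intro j
    have := (isPeriodicPt_shanksSeqMod_iff k (p ^ 2) b).1
      (Function.isPeriodicPt_minimalPeriod _ _) j
    exact (Dvd.intro_left ((p : ℤ)) (by push_cast; ring)).trans this
  have hba : b ∣ p * a := by
    refine Function.IsPeriodicPt.minimalPeriod_dvd ?_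
    rw [isPeriodicPt_shanksSeqMod_iff]
    intro j
    push_cast
    exact sq_dvd_shanksSeq_sub k p a ((isPeriodicPt_shanksSeqMod_iff k p a).1
      (Function.isPeriodicPt_minimalPeriod _ _)) p j dvd_rfl
  obtain ⟨c, hc⟩ := hab
  rcases Nat.eq_zero_or_pos a with h0 | hpos
  · left
    rw [hc, h0, zero_mul]
  · rw [hc, mul_comm p a] at hba
    rcases (Nat.dvd_prime hp).1 (Nat.dvd_of_mul_dvd_mul_left hpos hba) with rfl | rfl
    · left
      rw [hc, mul_one]
    · right
      rw [hc, mul_comm]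
end

section
/- Let k ≥ 1 be an integer with k ≢ 3 (mod 9) such that D is squarefree. Then the Shanks polynomial S_k(x) is monogenic; that is, if ρ is a root of S_k and K = ℚ(ρ), then the ring of integers of K equals ℤ[ρ] (equivalently, {1, ρ, ρ²} is a ℤ-basis of the ring of integers of K). -/
open Polynomial IntermediateField

open NumberField

/-- Eisenstein's criterion for a monic cubic, at an integer prime. -/
theorem Cubic.isEisensteinAt_of_dvd {p a b c : ℤ} (hp : Prime p) (ha : p ∣ a) (hb : p ∣ b)
    (hc : p ∣ c) (hc2 : ¬ p ^ 2 ∣ c) :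
    (Cubic.toPoly ⟨1, a, b, c⟩).IsEisensteinAt (Ideal.span {p}) where
  leading := by
    rw [Cubic.leadingCoeff_of_a_ne_zero' one_ne_zero, Ideal.mem_span_singleton]
    exact hp.not_dvd_one
  mem {n} hn := by
    rw [Cubic.natDegree_of_a_ne_zero' one_ne_zero] at hn
    rw [Ideal.mem_span_singleton]
    interval_cases n <;> simpa
  notMem := by
    rw [Ideal.span_singleton_pow, Ideal.mem_span_singleton]
    simpa

theorem Cubic.aeval_toPoly_int {R : Type*} [CommRing R] (a b c d : ℤ) (x : R) :
    aeval x (Cubic.toPoly ⟨a, b, c, d⟩) = a * x ^ 3 + b * x ^ 2 + c * x + d := by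
  simp only [Cubic.toPoly, map_add, map_mul, map_pow, aeval_X, aeval_C, algebraMap_int_eq,
    Int.coe_castRingHom]

theorem Cubic.aeval_derivative_toPoly_int {R : Type*} [CommRing R] (a b c d : ℤ) (x : R) :
    aeval x (derivative (Cubic.toPoly ⟨a, b, c, d⟩)) = 3 * a * x ^ 2 + 2 * b * x + c := by
  simp only [Cubic.toPoly, derivative_C_mul, derivative_X_pow, derivative_X,
    derivative_C, map_add, map_mul, map_pow, aeval_X, aeval_C, algebraMap_int_eq,
    Int.coe_castRingHom, map_one, map_zero]
  push_cast
  ring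

theorem mem_adjoin_int_coe_iff {K : Type*} [Field K] {x z : 𝓞 K} :
    (z : K) ∈ Algebra.adjoin ℤ {(x : K)} ↔ z ∈ Algebra.adjoin ℤ {x} := by
  have h : Algebra.adjoin ℤ {(x : K)} =
      (Algebra.adjoin ℤ {x}).map (IsScalarTower.toAlgHom ℤ (𝓞 K) K) := by
    rw [AlgHom.map_adjoin, Set.image_singleton]; rfl
  rw [h, Subalgebra.mem_map]
  refine ⟨?_, fun hz => ⟨z, hz, rfl⟩⟩
  rintro ⟨w, hw, hwz⟩
  rwa [← RingOfIntegers.coe_injective hwz]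

section

variable {K : Type*} [Field K] [NumberField K]

theorem minpoly_int_eq_of_irreducible {x : 𝓞 K} {f : ℤ[X]} (hf : f.Monic) (hirr : Irreducible f)
    (hx : aeval x f = 0) : minpoly ℤ x = f := by
  have hint : IsIntegral ℤ x := ⟨f, hf, hx⟩
  have hdvd := minpoly.isIntegrallyClosed_dvd hint hx
  exact eq_of_monic_of_associated (minpoly.monic hint) hf
    (associated_of_dvd_dvd hdvd
      ((hirr.dvd_iff.mp hdvd).resolve_left (minpoly.not_isUnit ℤ x)).dvd)

theorem adjoin_rat_eq_top {x : K} (hgen : ℚ⟮x⟯ = ⊤) : Algebra.adjoin ℚ {x} = ⊤ := by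
  rw [← IntermediateField.adjoin_simple_toSubalgebra_of_isAlgebraic
    (Algebra.IsAlgebraic.isAlgebraic (R := ℚ) x), hgen, IntermediateField.top_toSubalgebra]

theorem mem_adjoin_of_prime_mul_mem_of_isEisensteinAt {p : ℤ} (hp : Prime p) {x z : 𝓞 K}
    (hgen : ℚ⟮(x : K)⟯ = ⊤) {f : ℤ[X]} (hf : f.Monic) (hdeg : 0 < f.natDegree)
    (hei : f.IsEisensteinAt (Ideal.span {p})) (hx : aeval x f = 0)
    (hz : (p : 𝓞 K) * z ∈ Algebra.adjoin ℤ {x}) : z ∈ Algebra.adjoin ℤ {x} := by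
  have hirr : Irreducible f := hei.irreducible
    ((Ideal.span_singleton_prime hp.ne_zero).mpr hp) hf.isPrimitive hdeg
  let B := PowerBasis.ofAdjoinEqTop' (Algebra.IsIntegral.isIntegral (R := ℚ) (x : K))
    (adjoin_rat_eq_top hgen)
  have hB : B.gen = (x : K) := PowerBasis.ofAdjoinEqTop'_gen _ _
  have hmin : minpoly ℤ B.gen = f := by
    rw [hB, ← minpoly_int_eq_of_irreducible hf hirr hx]
    exact minpoly.algebraMap_eq RingOfIntegers.coe_injective x
  rw [← mem_adjoin_int_coe_iff, ← hB]
  refine mem_adjoin_of_smul_prime_smul_of_minpoly_isEisensteinAt (R := ℤ) (K := ℚ) hp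
    (hB ▸ x.isIntegral_coe) z.isIntegral_coe ?_ (hmin ▸ hei)
  rw [hB]
  have := mem_adjoin_int_coe_iff.mpr hz
  simpa [zsmul_eq_mul] using this

theorem exists_pow_mul_mem_adjoin {R : Type*} [CommRing R] {m : ℤ} {x y a : R}
    (h : (m : R) * x ∈ Algebra.adjoin ℤ {y}) (ha : a ∈ Algebra.adjoin ℤ {x}) :
    ∃ n : ℕ, (m : R) ^ n * a ∈ Algebra.adjoin ℤ {y} := by
  have hm (n : ℕ) : (m : R) ^ n ∈ Algebra.adjoin ℤ {y} := pow_mem (intCast_mem _ m) n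
  induction ha using Algebra.adjoin_induction with
  | mem z hz =>
    rw [Set.mem_singleton_iff.mp hz]
    exact ⟨1, by simpa using h⟩
  | algebraMap r => exact ⟨0, by simp⟩
  | add z w _ _ hz hw =>
    obtain ⟨i, hi⟩ := hz
    obtain ⟨j, hj⟩ := hw
    refine ⟨i + j, ?_⟩
    convert add_mem (mul_mem (hm j) hi) (mul_mem (hm i) hj) using 1
    ring
  | mul z w _ _ hz hw =>
    obtain ⟨i, hi⟩ := hz
    obtain ⟨j, hj⟩ := hw
    refine ⟨i + j, ?_⟩
    convert mul_mem hi hj using 1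
    ring

theorem mem_of_isCoprime_mul_mem {R : Type*} [CommRing R] {A : Subring R} {m n : ℤ}
    (h : IsCoprime m n) {a : R} (hm : (m : R) * a ∈ A) (hn : (n : R) * a ∈ A) : a ∈ A := by
  obtain ⟨u, v, huv⟩ := h
  have huv' : (u : R) * m + v * n = 1 := by
    exact_mod_cast congrArg (Int.cast : ℤ → R) huv
  convert add_mem (mul_mem (intCast_mem A u) hm) (mul_mem (intCast_mem A v) hn) using 1
  linear_combination -a * huv'

theorem mem_of_mul_mem_of_forall_prime {R : Type*} [CommRing R] {A : Subring R} {n : ℤ}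
    (hn : n ≠ 0)
    (h : ∀ p : ℤ, Prime p → p ∣ n → ∀ a : R, (p : R) * a ∈ A → a ∈ A)
    {a : R} (ha : (n : R) * a ∈ A) : a ∈ A := by
  induction n using UniqueFactorizationMonoid.induction_on_prime generalizing a with
  | h₁ => exact absurd rfl hn
  | h₂ u hu =>
    obtain rfl | rfl := Int.isUnit_iff.mp hu
    · simpa using ha
    · simpa using ha
  | h₃ m p hm hp ih =>
    refine ih hm (fun q hq hqm => h q hq (hqm.mul_left p)) (h p hp (dvd_mul_right p m) _ ?_)
    rwa [← mul_assoc, ← Int.cast_mul]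

theorem aeval_derivative_minpoly_mul_mem_adjoin {x : 𝓞 K} (hgen : ℚ⟮(x : K)⟯ = ⊤) (z : 𝓞 K) :
    aeval x (derivative (minpoly ℤ x)) * z ∈ Algebra.adjoin ℤ {x} := by
  have h := conductor_mul_differentIdeal ℤ ℚ K x (adjoin_rat_eq_top hgen)
  have hmem : aeval x (derivative (minpoly ℤ x)) ∈ conductor ℤ x := by
    refine Ideal.mul_le_left (J := differentIdeal ℤ (𝓞 K)) ?_
    rw [h]
    exact Ideal.mem_span_singleton_self _
  exact mem_conductor_iff.mp hmem z

theorem adjoin_rat_coe_eq_top_of_eq {x y : 𝓞 K} (hgen : ℚ⟮(x : K)⟯ = ⊤) {m n : ℤ} (hm : m ≠ 0)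
    (hy : y = (m : 𝓞 K) * x - n) : ℚ⟮(y : K)⟯ = ⊤ := by
  rw [eq_top_iff, ← hgen, IntermediateField.adjoin_simple_le_iff]
  have hm' : (m : K) ≠ 0 := by exact_mod_cast hm
  have hx : (x : K) = ((y : K) + (n : K)) / (m : K) := by
    rw [hy, eq_div_iff hm']
    simp
    ring
  rw [hx]
  exact div_mem (add_mem (IntermediateField.mem_adjoin_simple_self ℚ _) (intCast_mem _ n))
    (intCast_mem _ m)

end

theorem irreducible_shanks (k : ℤ) : Irreducible (Cubic.toPoly ⟨1, -k, -(k + 3), -1⟩) := by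
  rw [(Cubic.monic_of_a_eq_one').irreducible_iff_roots_eq_zero_of_degree_le_three
    (by rw [Cubic.natDegree_of_a_ne_zero' one_ne_zero]; norm_num)
    (by rw [Cubic.natDegree_of_a_ne_zero' one_ne_zero])]
  refine Multiset.eq_zero_of_forall_notMem fun r hr => ?_
  have hr := (isRoot_of_mem_roots hr).eq_zero
  simp only [Cubic.toPoly, eval_add, eval_mul, eval_C, eval_pow, eval_X] at hr
  have hu : IsUnit r := IsUnit.of_mul_eq_one (r ^ 2 - k * r - (k + 3)) (by linear_combination hr)
  obtain rfl | rfl := Int.isUnit_iff.mp hu <;> omega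

theorem not_prime_sq_dvd_of_squarefree {k p : ℤ}
    (hD : Squarefree (if (3 : ℤ) ∣ k then (k / 3) ^ 2 + k / 3 + 1 else k ^ 2 + 3 * k + 9))
    (hp : Prime p) (hp3 : IsCoprime p 3) : ¬ p ^ 2 ∣ k ^ 2 + 3 * k + 9 := by
  intro h
  refine hp.not_isUnit (hD p ?_)
  rw [← sq]
  split_ifs with h3
  · obtain ⟨m, rfl⟩ := h3
    rw [Int.mul_ediv_cancel_left _ three_ne_zero]
    rw [show (3 * m) ^ 2 + 3 * (3 * m) + 9 = 3 ^ 2 * (m ^ 2 + m + 1) by ring] at h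
    exact hp3.pow.dvd_of_dvd_mul_left h
  · exact h

theorem isCoprime_two_mul_add_three {k p : ℤ} (hp3 : IsCoprime p 3)
    (hpΔ : p ∣ k ^ 2 + 3 * k + 9) : IsCoprime p (2 * k + 3) := by
  obtain ⟨c, hc⟩ := hpΔ
  obtain ⟨u, v, h⟩ := hp3.pow_right (n := 3)
  exact ⟨u + 4 * v * c, -v * (2 * k + 3), by linear_combination h - 4 * v * hc⟩

/-- Let `k ≥ 1` with `k ≢ 3 (mod 9)` be such that `D` is
squarefree, where `D = (k/3)² + k/3 + 1` if `3 ∣ k` and `D = k² + 3k + 9`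
otherwise.  Then the Shanks polynomial `S_k(x) = x³ − k·x² − (k+3)·x − 1` is
monogenic: if `ρ` is a root of `S_k` and `K = ℚ(ρ)`, then the ring of integers
of `K` equals `ℤ[ρ]`. -/
theorem shanks_monogenic (k : ℤ) (hk : 1 ≤ k) (hk9 : ¬ k ≡ 3 [ZMOD 9])
    (hD : Squarefree (if (3 : ℤ) ∣ k then (k / 3) ^ 2 + k / 3 + 1 else k ^ 2 + 3 * k + 9))
    (K : Type*) [Field K] [NumberField K] (ρ : NumberField.RingOfIntegers K)
    (hρ : ρ ^ 3 - (k : NumberField.RingOfIntegers K) * ρ ^ 2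
      - ((k : NumberField.RingOfIntegers K) + 3) * ρ - 1 = 0)
    (hgen : ℚ⟮(ρ : K)⟯ = ⊤) :
    Algebra.adjoin ℤ ({ρ} : Set (NumberField.RingOfIntegers K)) = ⊤ := by
  have hmin : minpoly ℤ ρ = Cubic.toPoly ⟨1, -k, -(k + 3), -1⟩ := by
    refine minpoly_int_eq_of_irreducible Cubic.monic_of_a_eq_one' (irreducible_shanks k) ?_
    rw [Cubic.aeval_toPoly_int]
    push_cast
    linear_combination hρ
  have hdisc : aeval ρ (derivative (minpoly ℤ ρ)) * (2 * ρ ^ 2 - (2 * k + 1) * ρ - k - 4) =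
      ((k ^ 2 + 3 * k + 9 : ℤ) : 𝓞 K) := by
    rw [hmin, Cubic.aeval_derivative_toPoly_int]
    push_cast
    linear_combination (6 * ρ - 4 * k - 3) * hρ
  rw [Algebra.eq_top_iff]
  intro z
  refine mem_of_mul_mem_of_forall_prime (A := (Algebra.adjoin ℤ {ρ}).toSubring)
    (n := k ^ 2 + 3 * k + 9) (by positivity) ?_ ?_
  swap
  · rw [← hdisc, mul_assoc]
    exact aeval_derivative_minpoly_mul_mem_adjoin hgen _
  intro p hp hpΔ a ha
  rw [Subalgebra.mem_toSubring] at ha ⊢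
  have hρmem : ρ ∈ Algebra.adjoin ℤ {ρ} := Algebra.self_mem_adjoin_singleton ℤ ρ
  by_cases h3 : p ∣ 3
  · have h3p : 3 ∣ p := ((hp.associated_of_dvd Int.prime_three h3)).symm.dvd
    have h3k : (3 : ℤ) ∣ k := by
      refine Int.prime_three.dvd_of_dvd_pow (n := 2) ?_
      have := h3p.trans hpΔ
      omega
    have hle : Algebra.adjoin ℤ {ρ} = Algebra.adjoin ℤ {ρ - 1} := by
      refine le_antisymm (Algebra.adjoin_singleton_le ?_)
        (Algebra.adjoin_singleton_le (sub_mem hρmem (one_mem _)))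
      simpa using add_mem (Algebra.self_mem_adjoin_singleton ℤ (ρ - 1)) (one_mem _)
    have ha3 : ((3 : ℤ) : 𝓞 K) * a ∈ Algebra.adjoin ℤ {ρ} := by
      obtain ⟨c, hc⟩ := h3
      rw [hc, mul_comm p c, Int.cast_mul, mul_assoc]
      exact mul_mem (intCast_mem _ c) ha
    rw [hle] at ha3 ⊢
    refine mem_adjoin_of_prime_mul_mem_of_isEisensteinAt Int.prime_three
      (adjoin_rat_coe_eq_top_of_eq hgen one_ne_zero (n := 1) (by simp))
      (f := Cubic.toPoly ⟨1, 3 - k, -(3 * k), -(2 * k + 3)⟩) Cubic.monic_of_a_eq_one'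
      (by rw [Cubic.natDegree_of_a_ne_zero' one_ne_zero]; norm_num)
      (Cubic.isEisensteinAt_of_dvd Int.prime_three (by omega) (by omega) (by omega) ?_) ?_ ha3
    · rw [Int.ModEq] at hk9
      omega
    · rw [Cubic.aeval_toPoly_int]
      push_cast
      linear_combination hρ
  · have hp3 : IsCoprime p 3 := (Prime.coprime_iff_not_dvd hp).mpr h3
    have hcop := isCoprime_two_mul_add_three hp3 hpΔ
    set y : 𝓞 K := (3 : ℤ) * ρ - k with hy
    have hymem : y ∈ Algebra.adjoin ℤ {ρ} :=
      sub_mem (mul_mem (intCast_mem _ _) hρmem) (intCast_mem _ _)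
    have hρy : ((3 : ℤ) : 𝓞 K) * ρ ∈ Algebra.adjoin ℤ {y} := by
      simpa [hy] using add_mem (Algebra.self_mem_adjoin_singleton ℤ y) (intCast_mem _ k)
    obtain ⟨n, hn⟩ := exists_pow_mul_mem_adjoin hρy ha
    have hna : (((3 : ℤ) ^ n : ℤ) : 𝓞 K) * a ∈ Algebra.adjoin ℤ {y} := by
      refine mem_adjoin_of_prime_mul_mem_of_isEisensteinAt hp
        (adjoin_rat_coe_eq_top_of_eq hgen three_ne_zero hy)
        (f := Cubic.toPoly ⟨1, 0, -(3 * (k ^ 2 + 3 * k + 9)),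
          -((2 * k + 3) * (k ^ 2 + 3 * k + 9))⟩) Cubic.monic_of_a_eq_one'
        (by rw [Cubic.natDegree_of_a_ne_zero' one_ne_zero]; norm_num)
        (Cubic.isEisensteinAt_of_dvd hp (dvd_zero p) (hpΔ.mul_left _).neg_right
          (hpΔ.mul_left _).neg_right fun h => ?_) ?_ ?_
      · exact not_prime_sq_dvd_of_squarefree hD hp hp3
          (hcop.pow_left.dvd_of_dvd_mul_left (dvd_neg.mp h))
      · rw [Cubic.aeval_toPoly_int, hy]
        push_cast
        linear_combination 27 * hρ
      · convert hn using 1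
        push_cast
        ring
    exact mem_of_isCoprime_mul_mem (A := (Algebra.adjoin ℤ {ρ}).toSubring) hp3.pow_right ha
      (Algebra.adjoin_singleton_le hymem hna)
end
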